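/- Under conditions (B1)–(B4), √k (log Ẑ_{(k)} − log b*(n/k)) is bounded in probability (O_P(1)) as n → ∞, where Ẑ_{(k)} is the k-th largest among the absolute residuals Ẑ_1,…,Ẑ_n. -/

import Mathlib

open MeasureTheory ProbabilityTheory Filter Set
open scoped ProbabilityTheory

noncomputable section

namespace TailCusum

variable {Ω : Type*} [MeasureSpace Ω]

/-- `φ₁(x) = 1{x > 0}`. -/
def phi1 (x : ℝ) : ℝ := if 0 < x then 1 else 0

/-- `φ₂(x) = x₊ = max {x, 0}`. -/
def phi2 (x : ℝ) : ℝ := max x 0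

/-- positive part -/
def pos (x : ℝ) : ℝ := max x 0

/-- A positive measurable function `g` is regularly varying at `∞` with index `ρ` if
`g(λ x)/g(x) → λ^ρ` as `x → ∞` for every `λ > 0`. -/
def RegularlyVarying (g : ℝ → ℝ) (ρ : ℝ) : Prop :=
  Measurable g ∧ ∀ lam : ℝ, 0 < lam →
    Tendsto (fun x => g (lam * x) / g x) atTop (nhds (lam ^ ρ))

/-- `l` is slowly varying at `∞`. -/
def SlowlyVarying (l : ℝ → ℝ) : Prop :=
  Measurable l ∧ ∀ lam : ℝ, 0 < lam →
    Tendsto (fun x => l (lam * x) / l x) atTop (nhds 1)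

/-- `κ(λ) = K ∫_1^λ t^(γ-1) dt`. -/
def kappaFun (K γ : ℝ) (lam : ℝ) : ℝ := K * ∫ t in (1:ℝ)..lam, t ^ (γ - 1)

/-- Second-order regular variation condition on the slowly varying function `l`
(the core of condition (A2)): `(l(λx)/l(x) - 1)/g(x) → κ(λ)` with
`κ(λ) = K ∫_1^λ t^(γ-1) dt`, `g` positive and regularly varying with index `γ ≤ 0`. -/
def SecondOrderRV (l g : ℝ → ℝ) (K γ : ℝ) : Prop :=
  γ ≤ 0 ∧ (∀ x, 0 < g x) ∧ RegularlyVarying g γ ∧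
  ∀ lam : ℝ, 0 < lam →
    Tendsto (fun x => (l (lam * x) / l x - 1) / g x) atTop (nhds (kappaFun K γ lam))

/-- distribution function of a law on `ℝ` -/
def df (μ : Measure ℝ) (x : ℝ) : ℝ := (μ (Iic x)).toReal

/-- tail distribution function `F̄(x) = μ(x, ∞)` -/
def tailDF (μ : Measure ℝ) (x : ℝ) : ℝ := (μ (Ioi x)).toReal

/-- the quantile-type function `b(x) = inf {y : F(y) ≥ 1 - x⁻¹}` -/
def quantileB (μ : Measure ℝ) (x : ℝ) : ℝ := sInf {y : ℝ | 1 - x⁻¹ ≤ df μ y}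

/-- `F̄(x) = x^(-α) l(x)` for `x > 0` with `l` slowly varying: Pareto-type tail. -/
def ParetoTail (μ : Measure ℝ) (α : ℝ) (l : ℝ → ℝ) : Prop :=
  SlowlyVarying l ∧ ∀ x : ℝ, 0 < x → tailDF μ x = x ^ (-α) * l x

/-- strict stationarity of a sequence of random variables -/
def IsStationary (X : ℕ → Ω → ℝ) : Prop :=
  ∀ j : ℕ,
    Measure.map (fun ω => fun i : ℕ => X (i + j) ω) (ℙ : Measure Ω)
      = Measure.map (fun ω => fun i : ℕ => X i ω) (ℙ : Measure Ω)

/-- strict stationarity, `ℤ`-indexed -/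
def IsStationaryZ (X : ℤ → Ω → ℝ) : Prop :=
  ∀ j : ℤ,
    Measure.map (fun ω => fun i : ℤ => X (i + j) ω) (ℙ : Measure Ω)
      = Measure.map (fun ω => fun i : ℤ => X i ω) (ℙ : Measure Ω)

/-- The β-mixing coefficient of the sequence `X` at lag `lag`, expressed as
the supremum over `m` of the total-variation distance between the joint law of
`(X_1, …, X_m)` and `(X_{m+lag+1}, X_{m+lag+2}, …)` and the product of the two laws. -/
def betaMix (X : ℕ → Ω → ℝ) (lag : ℕ) : ℝ :=
  ⨆ m : ℕ, ⨆ S : Subtype (MeasurableSet : Set ((Fin m → ℝ) × (ℕ → ℝ)) → Prop),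
    |((Measure.map
        (fun ω => ((fun i : Fin m => X ((i : ℕ) + 1) ω, fun i : ℕ => X (m + lag + 1 + i) ω)))
        (ℙ : Measure Ω)) S.1).toReal
      - (((Measure.map (fun ω => fun i : Fin m => X ((i : ℕ) + 1) ω) (ℙ : Measure Ω)).prod
          (Measure.map (fun ω => fun i : ℕ => X (m + lag + 1 + i) ω) (ℙ : Measure Ω))) S.1).toReal|

/-- The tail sample fraction condition: `k → ∞` and `k = o(n)`. -/
def TailFraction (k : ℕ → ℕ) : Prop :=
  Tendsto (fun n : ℕ => (k n : ℝ)) atTop atTop ∧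
    Tendsto (fun n : ℕ => (k n : ℝ) / n) atTop (nhds 0)

/-- Condition (A1): `(n / r_n) β([ε r_n]) → 0` for every `ε > 0`, and `r_n² = o(k)`. -/
def CondA1 (X : ℕ → Ω → ℝ) (k r : ℕ → ℕ) : Prop :=
  (∀ n, 0 < r n) ∧
  (∀ ε : ℝ, 0 < ε →
    Tendsto (fun n : ℕ => ((n : ℝ) / r n) * betaMix X ⌊ε * r n⌋₊) atTop (nhds 0)) ∧
  Tendsto (fun n : ℕ => ((r n : ℝ) ^ 2 / k n)) atTop (nhds 0)

/-- Condition (A2): second-order regular variation of `l` plus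
`√k · g(b(n/k)) → A ∈ ℝ`. -/
def CondA2 (l g : ℝ → ℝ) (K γ A : ℝ) (b : ℝ → ℝ) (k : ℕ → ℕ) : Prop :=
  SecondOrderRV l g K γ ∧
    Tendsto (fun n : ℕ => Real.sqrt (k n) * g (b ((n : ℝ) / k n))) atTop (nhds A)

/-- covariance of two real random variables -/
def cov (f g : Ω → ℝ) : ℝ :=
  ∫ ω, (f ω - ∫ ω', f ω') * (g ω - ∫ ω', g ω')

/-- pairs `1 ≤ i < j ≤ N` -/
def pairsUpTo (N : ℕ) : Finset (ℕ × ℕ) :=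
  ((Finset.Icc 1 N) ×ˢ (Finset.Icc 1 N)).filter fun p => p.1 < p.2

/-- Condition (A3): existence of the limits `χ` and `ω` of the normalized sums of
covariances, for every `0 < ε < 1`. -/
def CondA3 (X : ℕ → Ω → ℝ) (b : ℝ → ℝ) (k r : ℕ → ℕ) (α χ ωc : ℝ) : Prop :=
  0 ≤ χ ∧ 0 ≤ ωc ∧
  ∀ ε : ℝ, 0 < ε → ε < 1 →
    (Tendsto (fun n : ℕ =>
        (2 * α ^ 2 * n / ((⌊ε * r n⌋₊ : ℝ) * k n)) *
          ∑ p ∈ pairsUpTo ⌊ε * r n⌋₊,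
            cov (fun ω => pos (Real.log (X p.1 ω) - Real.log (b ((n : ℝ) / k n))))
                (fun ω => pos (Real.log (X p.2 ω) - Real.log (b ((n : ℝ) / k n)))))
      atTop (nhds χ)) ∧
    (Tendsto (fun n : ℕ =>
        (2 * (n : ℝ) / ((⌊ε * r n⌋₊ : ℝ) * k n)) *
          ∑ p ∈ pairsUpTo ⌊ε * r n⌋₊,
            cov (fun ω => if b ((n : ℝ) / k n) < X p.1 ω then (1 : ℝ) else 0)
                (fun ω => if b ((n : ℝ) / k n) < X p.2 ω then (1 : ℝ) else 0))
      atTop (nhds ωc))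

/-- the `k`-th largest value among `X_1, …, X_n` -/
def orderStat (n k : ℕ) (X : ℕ → Ω → ℝ) (ω : Ω) : ℝ :=
  sInf {x : ℝ | ((Finset.Icc 1 n).filter fun i => x < X i ω).card < k}

/-- `|Σ_{i=1}^l Y_i - (l/n) Σ_{i=1}^n Y_i|` -/
def cusumAt (n : ℕ) (Y : ℕ → ℝ) (l : ℕ) : ℝ :=
  |∑ i ∈ Finset.Icc 1 l, Y i - ((l : ℝ) / n) * ∑ i ∈ Finset.Icc 1 n, Y i|

/-- The cusum statistic `T_n(φ)` with random threshold `X_(k)`. -/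
def cusum (n k : ℕ) (X : ℕ → Ω → ℝ) (φ : ℝ → ℝ) (ω : Ω) : ℝ :=
  (Real.sqrt k)⁻¹ *
    ⨆ l ∈ Finset.Icc 1 n,
      cusumAt n (fun i => φ (Real.log (X i ω) - Real.log (orderStat n k X ω))) l

/-- The cusum statistic with deterministic threshold `b(n/k)`. -/
def cusumDet (n k : ℕ) (X : ℕ → Ω → ℝ) (φ : ℝ → ℝ) (b : ℝ → ℝ) (ω : Ω) : ℝ :=
  (Real.sqrt k)⁻¹ *
    ⨆ l ∈ Finset.Icc 1 n,
      cusumAt n (fun i => φ (Real.log (X i ω) - Real.log (b ((n : ℝ) / k)))) l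

/-- convergence in distribution (weak convergence of laws) of real random variables to
a real random variable `Z` defined on a possibly different probability space -/
def TendstoInDist {Ω' : Type*} [MeasureSpace Ω'] (Y : ℕ → Ω → ℝ) (Z : Ω' → ℝ) : Prop :=
  ∀ f : ℝ → ℝ, Continuous f → (∃ C, ∀ x, |f x| ≤ C) →
    Tendsto (fun n : ℕ => ∫ ω, f (Y n ω)) atTop (nhds (∫ ω, f (Z ω)))

/-- convergence in distribution to a law `μ` on `ℝ` -/
def TendstoInLaw (Y : ℕ → Ω → ℝ) (μ : Measure ℝ) : Prop :=
  ∀ f : ℝ → ℝ, Continuous f → (∃ C, ∀ x, |f x| ≤ C) →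
    Tendsto (fun n : ℕ => ∫ ω, f (Y n ω)) atTop (nhds (∫ x, f x ∂μ))

/-- bounded in probability (`O_P(1)`) -/
def BddInProb (Y : ℕ → Ω → ℝ) : Prop :=
  ∀ ε : ℝ, 0 < ε → ∃ C : ℝ, ∀ᶠ n in atTop,
    ((ℙ : Measure Ω) {ω | C < |Y n ω|}).toReal < ε

/-- divergence to `+∞` in probability -/
def DivergesInProb (Y : ℕ → Ω → ℝ) : Prop :=
  ∀ C : ℝ, Tendsto (fun n : ℕ => ((ℙ : Measure Ω) {ω | Y n ω ≤ C}).toReal) atTop (nhds 0)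

/-- standard Brownian motion on `[0, ∞)` -/
structure IsStdBrownianMotion {Ω' : Type*} [MeasureSpace Ω'] (B : ℝ → Ω' → ℝ) : Prop where
  isProb : IsProbabilityMeasure (ℙ : Measure Ω')
  meas : ∀ t, Measurable (B t)
  start : ∀ᵐ ω ∂(ℙ : Measure Ω'), B 0 ω = 0
  gauss_incr : ∀ s t : ℝ, 0 ≤ s → s ≤ t →
    Measure.map (fun ω => B t ω - B s ω) (ℙ : Measure Ω')
      = gaussianReal 0 (Real.toNNReal (t - s))
  indep_incr : ∀ (n : ℕ) (ts : ℕ → ℝ), (∀ i, 0 ≤ ts i) → Monotone ts →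
    iIndepFun (m := fun _ => Real.measurableSpace)
      (fun i : Fin n => fun ω => B (ts ((i : ℕ) + 1)) ω - B (ts (i : ℕ)) ω)
      (ℙ : Measure Ω')

/-- `sup_{0 ≤ t ≤ 1} |B°(t)|` where `B°(t) = B(t) - t B(1)` is the Brownian bridge
associated with the Brownian motion `B` -/
def supAbsBrownianBridge {Ω' : Type*} [MeasureSpace Ω'] (B : ℝ → Ω' → ℝ) (ω : Ω') : ℝ :=
  ⨆ t : Icc (0 : ℝ) 1, |B (t : ℝ) ω - (t : ℝ) * B 1 ω|

/-- `A_i(ζ) = φ(log X_i - log b(n/k) + ζ/√k)` -/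
def An (X : ℕ → Ω → ℝ) (b : ℝ → ℝ) (φ : ℝ → ℝ) (n k : ℕ) (ζ : ℝ) (i : ℕ) (ω : Ω) : ℝ :=
  φ (Real.log (X i ω) - Real.log (b ((n : ℝ) / k)) + ζ / Real.sqrt k)

/-- the tail sequential process `M_n(t, ζ) = k^{-1/2} Σ_{i=1}^{[nt]} (A_i(ζ) - E A_1(ζ))` -/
def Mn (X : ℕ → Ω → ℝ) (b : ℝ → ℝ) (φ : ℝ → ℝ) (n k : ℕ) (t ζ : ℝ) (ω : Ω) : ℝ :=
  (Real.sqrt k)⁻¹ * ∑ i ∈ Finset.Icc 1 ⌊(n : ℝ) * t⌋₊,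
    (An X b φ n k ζ i ω - ∫ ω', An X b φ n k ζ 1 ω')

/-- residual `ξ̂_i = X_i - Σ_{j=1}^p φ̂_j X_{i-j}` of an AR(p) fit -/
def residual (p : ℕ) (X : ℤ → Ω → ℝ) (φh : Ω → Fin p → ℝ) (i : ℕ) (ω : Ω) : ℝ :=
  X i ω - ∑ j : Fin p, φh ω j * X ((i : ℤ) - ((j : ℕ) + 1)) ω

/-- absolute residual `Ẑ_i = |ξ̂_i|` -/
def Zhat (p : ℕ) (X : ℤ → Ω → ℝ) (φh : Ω → Fin p → ℝ) (i : ℕ) (ω : Ω) : ℝ :=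
  |residual p X φh i ω|

/-- stationarity of the restriction of `Y` to the segment of indices `[a, b]` -/
def SegStationary (a b : ℕ) (Y : ℕ → Ω → ℝ) : Prop :=
  ∀ (m : ℕ) (s : Fin m → ℕ) (j : ℕ), (∀ q, a ≤ s q ∧ s q + j ≤ b) →
    Measure.map (fun ω => fun q : Fin m => Y (s q + j) ω) (ℙ : Measure Ω)
      = Measure.map (fun ω => fun q : Fin m => Y (s q) ω) (ℙ : Measure Ω)

/-- the row-wise mixing coefficient
`β_n(l) = sup_m sup {|P(A∩B) - P(A)P(B)| : A ∈ σ(Y_i : m+l+1 ≤ i ≤ n), B ∈ σ(Y_1,…,Y_m)}` -/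
def betaMixRow (n : ℕ) (Y : ℕ → Ω → ℝ) (lag : ℕ) : ℝ :=
  ⨆ m : ℕ, ⨆ As : Subtype (MeasurableSet : Set (Fin (n - (m + lag)) → ℝ) → Prop),
    ⨆ Bs : Subtype (MeasurableSet : Set (Fin m → ℝ) → Prop),
      |((ℙ : Measure Ω)
          (((fun ω => fun i : Fin (n - (m + lag)) => Y (m + lag + 1 + (i : ℕ)) ω) ⁻¹' As.1)
            ∩ ((fun ω => fun i : Fin m => Y ((i : ℕ) + 1) ω) ⁻¹' Bs.1))).toReal
        - ((ℙ : Measure Ω)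
            ((fun ω => fun i : Fin (n - (m + lag)) => Y (m + lag + 1 + (i : ℕ)) ω) ⁻¹' As.1)).toReal
          * ((ℙ : Measure Ω)
            ((fun ω => fun i : Fin m => Y ((i : ℕ) + 1) ω) ⁻¹' Bs.1)).toReal|

/-! ### Tail distribution functions and quantiles -/

section Tail

variable {μ : Measure ℝ}

lemma tailDF_nonneg (x : ℝ) : 0 ≤ tailDF μ x := ENNReal.toReal_nonneg

lemma quantile_bddBelow (hμ : μ (Iio 0) = 0) {y : ℝ} (hy : 1 < y) :
    0 ∈ lowerBounds {x : ℝ | 1 - y⁻¹ ≤ df μ x} := by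
  intro x hx
  by_contra! h
  have h0 : df μ x = 0 := by
    rw [df, measure_mono_null (Iic_subset_Iio.2 h) hμ, ENNReal.toReal_zero]
  have := inv_lt_one_of_one_lt₀ hy
  simp only [mem_ofPred_eq, h0] at hx
  linarith

variable [IsProbabilityMeasure μ]

lemma df_add_tailDF (x : ℝ) : df μ x + tailDF μ x = 1 := by
  have h := prob_add_prob_compl (μ := μ) (measurableSet_Iic (a := x))
  rw [compl_Iic] at h
  rw [df, tailDF, ← ENNReal.toReal_add (measure_ne_top _ _) (measure_ne_top _ _), h,
    ENNReal.toReal_one]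

lemma antitone_tailDF : Antitone (tailDF μ) := fun _ _ h =>
  ENNReal.toReal_mono (measure_ne_top _ _) (measure_mono (Ioi_subset_Ioi h))

lemma tendsto_tailDF_nhdsGT (x : ℝ) :
    Tendsto (tailDF μ) (nhdsWithin x (Ioi x)) (nhds (tailDF μ x)) := by
  have h := (cdf μ).right_continuous x
  have hdf : ∀ y, tailDF μ y = 1 - cdf μ y := fun y => by
    have := df_add_tailDF (μ := μ) y
    rw [df, ← measureReal_def, ← cdf_eq_real] at this
    linarith
  have h' := (h.mono (Ioi_subset_Ici_self)).tendsto.const_sub 1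
  rw [hdf x]
  exact h'.congr fun y => (hdf y).symm

lemma tendsto_tailDF_atTop : Tendsto (tailDF μ) atTop (nhds 0) := by
  have hdf : ∀ y, tailDF μ y = 1 - cdf μ y := fun y => by
    have := df_add_tailDF (μ := μ) y
    rw [df, ← measureReal_def, ← cdf_eq_real] at this
    linarith
  have h' := (tendsto_cdf_atTop μ).const_sub 1
  rw [sub_self] at h'
  exact h'.congr fun y => (hdf y).symm

lemma mem_quantile_iff (x y : ℝ) : 1 - y⁻¹ ≤ df μ x ↔ tailDF μ x ≤ y⁻¹ := by
  have := df_add_tailDF (μ := μ) x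
  constructor <;> intro h <;> linarith

lemma lt_tailDF_of_lt_quantileB (hμ : μ (Iio 0) = 0) {x y : ℝ} (hy : 1 < y)
    (hx : x < quantileB μ y) : y⁻¹ < tailDF μ x := by
  by_contra! h
  exact absurd (csInf_le ⟨0, quantile_bddBelow hμ hy⟩ ((mem_quantile_iff x y).2 h)) (not_le.2 hx)

lemma tailDF_quantileB_le {y : ℝ} (hy : 1 < y) :
    tailDF μ (quantileB μ y) ≤ y⁻¹ := by
  have hne : {x : ℝ | 1 - y⁻¹ ≤ df μ x}.Nonempty := by
    have h := (tendsto_tailDF_atTop (μ := μ)).eventually_le_const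
      (inv_pos.2 (zero_lt_one.trans hy))
    obtain ⟨x, hx⟩ := h.exists
    exact ⟨x, (mem_quantile_iff x y).2 hx⟩
  refine le_of_tendsto (tendsto_tailDF_nhdsGT _) ?_
  filter_upwards [self_mem_nhdsWithin] with x hx
  obtain ⟨z, hz, hzx⟩ := exists_lt_of_csInf_lt hne hx
  exact (antitone_tailDF hzx.le).trans ((mem_quantile_iff z y).1 hz)

lemma tendsto_quantileB (hpos : ∀ x, 0 < tailDF μ x) :
    Tendsto (quantileB μ) atTop atTop := by
  refine tendsto_atTop.2 fun K => ?_
  filter_upwards [eventually_gt_atTop 1, eventually_gt_atTop (tailDF μ K)⁻¹] with y hy hyK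
  by_contra! h
  have h1 := antitone_tailDF (μ := μ) h.le
  have h2 := inv_lt_of_inv_lt₀ (hpos K) hyK
  linarith [tailDF_quantileB_le (μ := μ) hy]

end Tail

/-! ### Regular variation of the tail -/

section RegularVariation

variable {μ : Measure ℝ} [IsProbabilityMeasure μ] {α : ℝ} {l : ℝ → ℝ}

lemma SlowlyVarying.eventually_ne_zero (h : SlowlyVarying l) : ∀ᶠ x in atTop, l x ≠ 0 := by
  filter_upwards [(h.2 1 one_pos).eventually_ne one_ne_zero] with x hx h0
  simp [h0] at hx

lemma ParetoTail.pos (h : ParetoTail μ α l) (x : ℝ) : 0 < tailDF μ x := by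
  obtain ⟨y, hy, hxy, hy0⟩ := (h.1.eventually_ne_zero.and
    ((eventually_ge_atTop x).and (eventually_gt_atTop 0))).exists
  have hne : tailDF μ y ≠ 0 := by
    rw [h.2 y hy0]
    exact mul_ne_zero (Real.rpow_pos_of_pos hy0 _).ne' hy
  exact ((tailDF_nonneg y).lt_of_ne' hne).trans_le (antitone_tailDF hxy)

lemma ParetoTail.slow_pos (h : ParetoTail μ α l) {x : ℝ} (hx : 0 < x) : 0 < l x := by
  have h1 := h.pos x
  rw [h.2 x hx] at h1
  exact pos_of_mul_pos_right h1 (Real.rpow_pos_of_pos hx _).le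

lemma ParetoTail.tailDF_mul (h : ParetoTail μ α l) {s x : ℝ} (hs : 0 < s) (hx : 0 < x) :
    tailDF μ (s * x) = s ^ (-α) * (l (s * x) / l x) * tailDF μ x := by
  rw [h.2 _ (mul_pos hs hx), h.2 _ hx, Real.mul_rpow hs.le hx.le]
  field_simp [(h.slow_pos hx).ne']

lemma ParetoTail.exists_geometric_bound (h : ParetoTail μ α l) (hα : 0 < α) {s : ℝ} (hs : 1 < s) :
    ∃ q x₀ : ℝ, 0 < q ∧ q < 1 ∧ 0 < x₀ ∧
      ∀ x, x₀ ≤ x → ∀ j : ℕ, tailDF μ (s ^ j * x) ≤ q ^ j * tailDF μ x := by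
  have hs0 : 0 < s := one_pos.trans hs
  have hlim : Tendsto (fun x => s ^ (-α) * (l (s * x) / l x)) atTop (nhds (s ^ (-α) * 1)) :=
    (h.1.2 s hs0).const_mul _
  have hlt : s ^ (-α) < 1 := Real.rpow_lt_one_of_one_lt_of_neg hs (neg_lt_zero.2 hα)
  obtain ⟨q, hq, hq1⟩ := exists_between hlt
  have hev := hlim.eventually_lt_const (by simpa using hq)
  obtain ⟨x₁, hx₁⟩ := eventually_atTop.1 hev
  have hq0 : 0 < q := (Real.rpow_pos_of_pos hs0 _).trans hq
  refine ⟨q, max x₁ 1, hq0, hq1, by positivity, fun x hx j => ?_⟩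
  have hx0 : 0 < x := lt_of_lt_of_le one_pos ((le_max_right _ _).trans hx)
  induction j with
  | zero => simp
  | succ j ih =>
    have hge : x ≤ s ^ j * x := le_mul_of_one_le_left hx0.le (one_le_pow₀ hs.le)
    rw [pow_succ', mul_assoc, h.tailDF_mul hs0 (by positivity), pow_succ', mul_assoc q]
    exact mul_le_mul (hx₁ _ ((le_max_left _ _).trans (hx.trans hge))).le ih
      (tailDF_nonneg _) hq0.le

/-- Local uniformity in `λ` of the second-order condition, obtained from right-continuity of the
tail and the Baire category theorem. -/
lemma ParetoTail.exists_locally_uniform_bound (h : ParetoTail μ α l) {g : ℝ → ℝ} {K γ : ℝ}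
    (h2 : SecondOrderRV l g K γ) :
    ∃ η D x₀ : ℝ, 0 < η ∧ 0 < D ∧ ∀ x, x₀ ≤ x → ∀ t, |t| ≤ η →
      |l (Real.exp t * x) / l x - 1| ≤ D * g x := by
  obtain ⟨-, hgpos, hgRV, hlim⟩ := h2
  set E : ℕ → Set ℝ := fun m => {t | ∀ x, (m : ℝ) + 1 ≤ x →
    |l (Real.exp t * x) / l x - 1| ≤ m * g x} with hE
  have hcover : ⋃ m, closure (E m) = univ := by
    refine eq_univ_of_forall fun t => ?_
    have hb : ∃ C, ∀ᶠ x in atTop, |(l (Real.exp t * x) / l x - 1) / g x| ≤ C := by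
      refine ⟨|kappaFun K γ (Real.exp t)| + 1, ?_⟩
      exact ((hlim _ (Real.exp_pos t)).abs.eventually_le_const (lt_add_one _))
    obtain ⟨C, hC⟩ := hb
    obtain ⟨x₁, hx₁⟩ := eventually_atTop.1 hC
    obtain ⟨m, hm⟩ := exists_nat_ge (max C x₁)
    refine mem_iUnion.2 ⟨m, subset_closure fun x hx => ?_⟩
    have hx' : x₁ ≤ x := by linarith [le_max_right C x₁]
    have := hx₁ x hx'
    rw [abs_div, abs_of_pos (hgpos x), div_le_iff₀ (hgpos x)] at this
    exact this.trans (mul_le_mul_of_nonneg_right ((le_max_left _ _).trans hm) (hgpos x).le)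
  obtain ⟨m, t₀, ht₀⟩ := nonempty_interior_of_iUnion_of_closed
    (fun m => isClosed_closure (s := E m)) hcover
  obtain ⟨η, hη, hball⟩ := Metric.isOpen_iff.1 isOpen_interior t₀ ht₀
  have hsub : Metric.ball t₀ η ⊆ E m := by
    intro t ht x hx
    have hx0 : 0 < x := by have : (0:ℝ) ≤ m := Nat.cast_nonneg m; linarith
    have hfreq : ∃ᶠ s in nhdsWithin t (Ioi t), s ∈ E m := by
      rw [(nhdsGT_basis t).frequently_iff]
      intro b hb
      obtain ⟨c, hc, hcb⟩ := (nonempty_Ioo (a := t) (b := min b (t₀ + η))).2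
        (lt_min hb (by have := (abs_lt.1 (Metric.mem_ball.1 ht)).2; linarith))
      have hcl : c ∈ closure (E m) := interior_subset (hball (by
        have h1 := abs_lt.1 (Metric.mem_ball.1 ht)
        have h2 := lt_min_iff.1 hcb
        rw [Metric.mem_ball, Real.dist_eq, abs_lt]
        constructor <;> linarith))
      obtain ⟨s, hs, hsE⟩ := mem_closure_iff.1 hcl (Ioo t b) isOpen_Ioo
        ⟨hc, (lt_min_iff.1 hcb).1⟩
      exact ⟨s, hs, hsE⟩
    have hl : ∀ s, l (Real.exp s * x) = (Real.exp s * x) ^ α * tailDF μ (Real.exp s * x) := by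
      intro s
      rw [h.2 _ (by positivity), ← mul_assoc, ← Real.rpow_add (by positivity)]
      simp
    have hexp : Tendsto (fun s => Real.exp s * x) (nhdsWithin t (Ioi t))
        (nhdsWithin (Real.exp t * x) (Ioi (Real.exp t * x))) := by
      refine tendsto_nhdsWithin_iff.2 ⟨?_, ?_⟩
      · exact ((Real.continuous_exp.mul continuous_const).tendsto t).mono_left
          nhdsWithin_le_nhds
      · filter_upwards [self_mem_nhdsWithin] with s hs
        exact mul_lt_mul_of_pos_right (Real.exp_lt_exp.2 hs) hx0
    have hrc : Tendsto (fun s => l (Real.exp s * x)) (nhdsWithin t (Ioi t))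
        (nhds (l (Real.exp t * x))) := by
      simp_rw [hl]
      refine Tendsto.mul ?_ ((tendsto_tailDF_nhdsGT _).comp hexp)
      exact (hexp.mono_right nhdsWithin_le_nhds).rpow_const (Or.inl (by positivity))
    have htend := ((hrc.div_const (l x)).sub_const 1).abs
    exact le_of_tendsto_of_frequently htend (hfreq.mono fun s hs => hs x hx)
  obtain ⟨x₂, hx₂⟩ := eventually_atTop.1
    (((h.1.2 _ (Real.exp_pos t₀)).eventually_const_le (u := 1 / 2) (by norm_num)))
  obtain ⟨x₃, hx₃⟩ := eventually_atTop.1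
    ((hgRV.2 _ (Real.exp_pos (-t₀))).eventually_le_const (lt_add_one _))
  set B : ℝ := Real.exp (-t₀) ^ γ + 1
  have hB : 0 < B := by positivity
  have he : 0 < Real.exp t₀ := Real.exp_pos _
  refine ⟨η / 2, 4 * m * B + 1, max (Real.exp t₀ * max ((m : ℝ) + 1) (max x₂ 1)) x₃, by positivity,
    by positivity, fun y hy t ht => ?_⟩
  set x := Real.exp (-t₀) * y with hxdef
  have hyx : y = Real.exp t₀ * x := by
    rw [hxdef, ← mul_assoc, ← Real.exp_add]; simp
  have hxge : max ((m:ℝ) + 1) (max x₂ 1) ≤ x := by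
    have := (le_max_left _ _).trans hy
    rw [hyx] at this
    exact le_of_mul_le_mul_left this he
  have hxm := (le_max_left _ _).trans hxge
  have hxx₂ := (le_max_left _ _).trans ((le_max_right _ _).trans hxge)
  have hx0 : 0 < x := one_pos.trans_le ((le_max_right _ _).trans ((le_max_right _ _).trans hxge))
  have hA := hsub (show t + t₀ ∈ Metric.ball t₀ η by
    simp only [Metric.mem_ball, Real.dist_eq, add_sub_cancel_right]; linarith) x hxm
  have hB' := hsub (Metric.mem_ball_self hη) x hxm
  have hhalf := hx₂ x hxx₂
  have hg := hx₃ y ((le_max_right _ _).trans hy)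
  rw [div_le_iff₀ (hgpos y), ← hxdef] at hg
  have hlx := h.slow_pos hx0
  have hly := h.slow_pos (mul_pos he hx0)
  have hexp2 : Real.exp t * y = Real.exp (t + t₀) * x := by rw [hyx, Real.exp_add, mul_assoc]
  have hkey : l (Real.exp t * y) / l y - 1 =
      ((l (Real.exp (t + t₀) * x) / l x - 1) - (l (Real.exp t₀ * x) / l x - 1)) /
        (l (Real.exp t₀ * x) / l x) := by
    rw [hexp2, hyx]
    generalize l (Real.exp t₀ * x) = b at hly
    field_simp
    ring
  rw [hkey, abs_div, div_le_iff₀ (by positivity), abs_of_pos (a := _ / _) (by positivity)]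
  have h1 := abs_sub (l (Real.exp (t + t₀) * x) / l x - 1) (l (Real.exp t₀ * x) / l x - 1)
  have hm0 : (0:ℝ) ≤ m := Nat.cast_nonneg m
  have hgy := hgpos y
  calc _ ≤ m * g x + m * g x := h1.trans (add_le_add hA hB')
    _ = 2 * m * g x := by ring
    _ ≤ 2 * m * (B * g y) := by gcongr
    _ = (4 * m * B) * g y * (1 / 2) := by ring
    _ ≤ (4 * m * B + 1) * g y * (1 / 2) := by gcongr; linarith
    _ ≤ _ := by gcongr

end RegularVariation

/-! ### The companion operator of the autoregression -/

section Companion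

variable {p : ℕ}

/-- The companion operator of the autoregressive recursion with coefficients `φ`. -/
def companion (φ : Fin p → ℝ) : Module.End ℂ (Fin p → ℂ) where
  toFun v i := if (i : ℕ) = 0 then ∑ j, (φ j : ℂ) * v j else v ⟨i - 1, by omega⟩
  map_add' v w := by
    ext i
    by_cases h : (i : ℕ) = 0 <;> simp [h, mul_add, Finset.sum_add_distrib]
  map_smul' c v := by
    ext i
    by_cases h : (i : ℕ) = 0 <;> simp [h, Finset.mul_sum, mul_left_comm]

lemma companion_apply (φ : Fin p → ℝ) (v : Fin p → ℂ) (i : Fin p) :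
    companion φ v i = if (i : ℕ) = 0 then ∑ j, (φ j : ℂ) * v j else v ⟨i - 1, by omega⟩ := rfl

lemma norm_lt_one_of_mem_spectrum_companion (φ : Fin p → ℝ)
    (hroot : ∀ z : ℂ, ‖z‖ ≤ 1 → (1 : ℂ) - ∑ j : Fin p, (φ j : ℂ) * z ^ ((j : ℕ) + 1) ≠ 0)
    {c : ℂ} (hc : c ∈ spectrum ℂ (companion φ)) : ‖c‖ < 1 := by
  by_contra! h
  have hc0 : c ≠ 0 := norm_pos_iff.1 (one_pos.trans_le h)
  obtain ⟨v, hv⟩ := (Module.End.HasEigenvalue.of_mem_spectrum hc).exists_hasEigenvector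
  have hAv := hv.apply_eq_smul
  have hpow : ∀ (i : ℕ) (hi : i < p), v ⟨i, hi⟩ = c⁻¹ ^ i * v ⟨0, by omega⟩ := by
    intro i
    induction i with
    | zero => intro hi; simp
    | succ i ih =>
      intro hi
      have := congrFun hAv ⟨i + 1, hi⟩
      simp only [companion_apply, Nat.add_eq_zero_iff, one_ne_zero, and_false, if_false,
        Nat.add_sub_cancel, Pi.smul_apply, smul_eq_mul] at this
      rw [ih (by omega)] at this
      rw [pow_succ', mul_assoc, this]
      field_simp
  have hp : 0 < p := by
    rcases Nat.eq_zero_or_pos p with rfl | hp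
    · exact absurd (Subsingleton.elim v 0) hv.2
    · exact hp
  have hv0 : v ⟨0, hp⟩ ≠ 0 := by
    intro h0
    refine hv.2 (funext fun i => ?_)
    rw [hpow i i.2, h0, mul_zero, Pi.zero_apply]
  refine hroot c⁻¹ (by rw [norm_inv]; exact inv_le_one_of_one_le₀ h) ?_
  have h0 := congrFun hAv ⟨0, hp⟩
  simp only [companion_apply, if_true, Pi.smul_apply, smul_eq_mul] at h0
  have hsum : ∑ j : Fin p, (φ j : ℂ) * c⁻¹ ^ ((j : ℕ) + 1) =
      c⁻¹ * (v ⟨0, hp⟩)⁻¹ * ∑ j : Fin p, (φ j : ℂ) * v j := by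
    rw [Finset.mul_sum]
    refine Finset.sum_congr rfl fun j _ => ?_
    rw [hpow j j.2, pow_succ]
    field_simp
  rw [hsum, h0]
  field_simp
  simp

lemma exists_companion_pow_bound (hp : 0 < p) (φ : Fin p → ℝ)
    (hroot : ∀ z : ℂ, ‖z‖ ≤ 1 → (1 : ℂ) - ∑ j : Fin p, (φ j : ℂ) * z ^ ((j : ℕ) + 1) ≠ 0) :
    ∃ C r : ℝ, 0 < C ∧ 0 < r ∧ r < 1 ∧
      ∀ n : ℕ, ‖Module.End.toContinuousLinearMap (Fin p → ℂ) (companion φ) ^ n‖ ≤ C * r ^ n := by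
  set A := Module.End.toContinuousLinearMap (Fin p → ℂ) (companion φ)
  have : Nonempty (Fin p) := ⟨⟨0, hp⟩⟩
  have hrad : spectralRadius ℂ A < (1 : NNReal) := by
    refine spectrum.spectralRadius_lt_of_forall_lt A fun z hz => ?_
    rw [AlgEquiv.spectrum_eq] at hz
    exact norm_lt_one_of_mem_spectrum_companion φ hroot hz
  obtain ⟨r, hr, hr1⟩ := ENNReal.lt_iff_exists_nnreal_btwn.1 hrad
  have hr0 : 0 < r := by
    exact ENNReal.coe_pos.1 (bot_le.trans_lt hr)
  have hev := (spectrum.pow_nnnorm_pow_one_div_tendsto_nhds_spectralRadius A).eventually_lt_const hr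
  have hO : (fun n : ℕ => A ^ n) =O[atTop] fun n : ℕ => (r : ℝ) ^ n := by
    refine Asymptotics.IsBigO.of_bound 1 ?_
    filter_upwards [hev, eventually_gt_atTop 0] with n hn hn0
    have hn' : (0 : ℝ) < n := Nat.cast_pos.2 hn0
    have h1 : (‖A ^ n‖₊ : ENNReal) < (r : ENNReal) ^ (n : ℝ) := by
      have := ENNReal.rpow_lt_rpow hn hn'
      rwa [← ENNReal.rpow_mul, one_div, inv_mul_cancel₀ hn'.ne', ENNReal.rpow_one] at this
    rw [ENNReal.rpow_natCast, ← ENNReal.coe_pow, ENNReal.coe_lt_coe] at h1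
    rw [one_mul, Real.norm_of_nonneg (pow_nonneg r.coe_nonneg n)]
    exact_mod_cast h1.le
  obtain ⟨C, hC, hb⟩ := Asymptotics.bound_of_isBigO_nat_atTop hO
  refine ⟨C, r, hC, hr0, by exact_mod_cast hr1, fun n => ?_⟩
  have := hb (x := n) (pow_ne_zero n (by exact_mod_cast hr0.ne'))
  rwa [Real.norm_of_nonneg (pow_nonneg r.coe_nonneg n)] at this

lemma exists_moving_average_bound (hp : 0 < p) (φ : Fin p → ℝ)
    (hroot : ∀ z : ℂ, ‖z‖ ≤ 1 → (1 : ℂ) - ∑ j : Fin p, (φ j : ℂ) * z ^ ((j : ℕ) + 1) ≠ 0) :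
    ∃ C r : ℝ, 0 < C ∧ 0 < r ∧ r < 1 ∧ ∀ x ξ : ℤ → ℝ,
      (∀ i : ℤ, x i = ∑ j : Fin p, φ j * x (i - ((j : ℕ) + 1)) + ξ i) →
      ∀ (i : ℤ) (N : ℕ), |x i| ≤ ∑ j ∈ Finset.range N, C * r ^ j * |ξ (i - j)| +
        C * r ^ N * ∑ j : Fin p, |x (i - N - (j : ℕ))| := by
  obtain ⟨C, r, hC, hr, hr1, hb⟩ := exists_companion_pow_bound hp φ hroot
  refine ⟨C, r, hC, hr, hr1, fun x ξ hx i N => ?_⟩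
  set A := Module.End.toContinuousLinearMap (Fin p → ℂ) (companion φ)
  set V : ℤ → Fin p → ℂ := fun i j => (x (i - (j : ℕ)) : ℂ)
  set e : Fin p → ℂ := fun j => if (j : ℕ) = 0 then 1 else 0
  have hstep : ∀ i, V i = A (V (i - 1)) + (ξ i : ℂ) • e := by
    intro i
    ext j
    change V i j = companion φ (V (i - 1)) j + (ξ i : ℂ) * e j
    rw [companion_apply]
    by_cases h : (j : ℕ) = 0
    · simp only [V, e, h, if_true]
      simp only [Nat.cast_zero, sub_zero, mul_one]
      rw [hx i]
      push_cast
      simp only [sub_sub, add_comm (1 : ℤ)]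
    · simp only [V, e, h, if_false, mul_zero, add_zero]
      congr 2
      have : 1 ≤ (j : ℕ) := Nat.one_le_iff_ne_zero.2 h
      push_cast [this]
      ring
  have hiter : ∀ N : ℕ, V i = ∑ j ∈ Finset.range N, (ξ (i - j) : ℂ) • (A ^ j) e +
      (A ^ N) (V (i - N)) := by
    intro N
    induction N with
    | zero => simp
    | succ N ih =>
      rw [ih, Finset.sum_range_succ, hstep (i - N), map_add, map_smul, pow_succ]
      simp only [mul_apply_eq_comp]
      push_cast
      rw [show i - ((N : ℤ) + 1) = i - N - 1 by ring]
      abel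
  have he : ‖e‖ ≤ 1 := by
    refine (pi_norm_le_iff_of_nonneg zero_le_one).2 fun j => ?_
    simp only [e]
    split_ifs <;> simp
  have hV : ∀ i, ‖V i‖ ≤ ∑ j : Fin p, |x (i - (j : ℕ))| := by
    intro i
    refine (pi_norm_le_iff_of_nonneg (Finset.sum_nonneg fun _ _ => abs_nonneg _)).2 fun j => ?_
    simp only [V, Complex.norm_real, Real.norm_eq_abs]
    exact Finset.single_le_sum (f := fun j : Fin p => |x (i - (j : ℕ))|)
      (fun _ _ => abs_nonneg _) (Finset.mem_univ j)
  have h0 : |x i| ≤ ‖V i‖ := by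
    have := norm_le_pi_norm (V i) ⟨0, hp⟩
    simpa [V] using this
  refine h0.trans ?_
  rw [hiter N]
  refine (norm_add_le _ _).trans (add_le_add ((norm_sum_le _ _).trans
    (Finset.sum_le_sum fun j _ => ?_)) ?_)
  · rw [norm_smul, Complex.norm_real, Real.norm_eq_abs, mul_comm]
    refine mul_le_mul_of_nonneg_right ?_ (abs_nonneg _)
    exact ((A ^ j).le_opNorm e).trans (by
      calc ‖A ^ j‖ * ‖e‖ ≤ ‖A ^ j‖ * 1 := by gcongr
        _ ≤ C * r ^ j := by rw [mul_one]; exact hb j)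
  · exact ((A ^ N).le_opNorm _).trans
      (mul_le_mul (hb N) (hV _) (norm_nonneg _) (by positivity))

end Companion

/-! ### A maximal inequality for sums of independent variables -/

section Maximal

variable {Ω' : Type*} [MeasurableSpace Ω'] {P : Measure Ω'} [IsProbabilityMeasure P]

/-- Ottaviani's inequality for partial sums of independent complex random variables. -/
lemma ottaviani {ζ : ℕ → Ω' → ℂ} (hζ : ∀ i, Measurable (ζ i)) (hind : iIndepFun ζ P)
    {a c : ℝ} (N : ℕ)
    (hc : ∀ m ≤ N, P.real {ω | a < ‖∑ i ∈ Finset.Ico m N, ζ i ω‖} ≤ c) :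
    (1 - c) * P.real {ω | ∃ m ≤ N, 2 * a < ‖∑ i ∈ Finset.range m, ζ i ω‖} ≤
      P.real {ω | a < ‖∑ i ∈ Finset.range N, ζ i ω‖} := by
  set F : ℕ → Set Ω' := fun m => {ω | 2 * a < ‖∑ i ∈ Finset.range m, ζ i ω‖ ∧
    ∀ j < m, ‖∑ i ∈ Finset.range j, ζ i ω‖ ≤ 2 * a} with hF
  set R : ℕ → Set Ω' := fun m => {ω | ‖∑ i ∈ Finset.Ico m N, ζ i ω‖ ≤ a} with hR
  have hFm : ∀ m, MeasurableSet (F m) := by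
    intro m
    have hj : ∀ j, Measurable fun ω => ‖∑ i ∈ Finset.range j, ζ i ω‖ := fun j =>
      (Finset.measurable_fun_sum _ fun i _ => hζ i).norm
    have hset : F m = {ω | 2 * a < ‖∑ i ∈ Finset.range m, ζ i ω‖} ∩
        ⋂ j ∈ Finset.range m, {ω | ‖∑ i ∈ Finset.range j, ζ i ω‖ ≤ 2 * a} := by
      ext ω; simp [hF]
    rw [hset]
    exact (measurableSet_lt measurable_const (hj m)).inter
      (Finset.measurableSet_biInter _ fun j _ => measurableSet_le (hj j) measurable_const)
  have hRm : ∀ m, MeasurableSet (R m) := fun m => measurableSet_le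
    ((Finset.measurable_fun_sum _ fun i _ => hζ i).norm) measurable_const
  have hdisj : ∀ m n, m ≠ n → Disjoint (F m) (F n) := by
    have key : ∀ m n, m < n → Disjoint (F m) (F n) := fun m n h =>
      Set.disjoint_left.2 fun ω h1 h2 => absurd h1.1 (not_lt.2 (h2.2 m h))
    intro m n h
    rcases lt_or_gt_of_ne h with h | h
    · exact key m n h
    · exact (key n m h).symm
  have hindep : ∀ m ≤ N, P.real (F m ∩ R m) = P.real (F m) * P.real (R m) := by
    intro m _
    have hI := hind.indepFun_finset (Finset.range m) (Finset.Ico m N)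
      (Finset.disjoint_left.2 fun i hi hi' => by
        simp only [Finset.mem_range, Finset.mem_Ico] at hi hi'; omega) hζ
    have hmeas : ∀ (S T : Finset ℕ), Measurable fun t : S → ℂ =>
        ‖∑ i ∈ T, if h : i ∈ S then t ⟨i, h⟩ else 0‖ := by
      intro S T
      refine (Finset.measurable_fun_sum _ fun i _ => ?_).norm
      by_cases h : i ∈ S
      · simpa [h] using measurable_pi_apply _
      · simp [h]
    have hval : ∀ (S T : Finset ℕ) ω, T ⊆ S →
        (∑ i ∈ T, if h : i ∈ S then (fun i : S => ζ i ω) ⟨i, h⟩ else 0) = ∑ i ∈ T, ζ i ω := by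
      intro S T ω hTS
      refine Finset.sum_congr rfl fun i hi => ?_
      simp [hTS hi]
    have hFset : MeasurableSet {t : Finset.range m → ℂ |
        2 * a < ‖∑ i ∈ Finset.range m, if h : i ∈ Finset.range m then t ⟨i, h⟩ else 0‖ ∧
        ∀ j ∈ Finset.range m,
          ‖∑ i ∈ Finset.range j, if h : i ∈ Finset.range m then t ⟨i, h⟩ else 0‖ ≤ 2 * a} := by
      have hset : {t : Finset.range m → ℂ |
          2 * a < ‖∑ i ∈ Finset.range m, if h : i ∈ Finset.range m then t ⟨i, h⟩ else 0‖ ∧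
          ∀ j ∈ Finset.range m,
            ‖∑ i ∈ Finset.range j, if h : i ∈ Finset.range m then t ⟨i, h⟩ else 0‖ ≤ 2 * a} =
          {t | 2 * a < ‖∑ i ∈ Finset.range m,
            if h : i ∈ Finset.range m then t ⟨i, h⟩ else 0‖} ∩
          ⋂ j ∈ Finset.range m, {t | ‖∑ i ∈ Finset.range j,
            if h : i ∈ Finset.range m then t ⟨i, h⟩ else 0‖ ≤ 2 * a} := by
        ext t; simp
      rw [hset]
      exact (measurableSet_lt measurable_const (hmeas _ _)).inter
        (Finset.measurableSet_biInter _ fun j _ => measurableSet_le (hmeas _ _) measurable_const)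
    have hRset : MeasurableSet {t : Finset.Ico m N → ℂ |
        ‖∑ i ∈ Finset.Ico m N, if h : i ∈ Finset.Ico m N then t ⟨i, h⟩ else 0‖ ≤ a} :=
      measurableSet_le (hmeas _ _) measurable_const
    have := hI.measure_inter_preimage_eq_mul _ _ hFset hRset
    have hF' : F m = (fun ω (i : Finset.range m) => ζ i ω) ⁻¹' {t : Finset.range m → ℂ |
        2 * a < ‖∑ i ∈ Finset.range m, if h : i ∈ Finset.range m then t ⟨i, h⟩ else 0‖ ∧
        ∀ j ∈ Finset.range m,
          ‖∑ i ∈ Finset.range j, if h : i ∈ Finset.range m then t ⟨i, h⟩ else 0‖ ≤ 2 * a} := by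
      ext ω
      simp only [hF, mem_ofPred_eq, mem_preimage]
      rw [hval _ _ _ subset_rfl]
      refine and_congr_right fun _ => forall_congr' fun j => ?_
      rw [Finset.mem_range]
      refine imp_congr_right fun hj => ?_
      rw [hval _ _ _ (Finset.range_subset_range.2 hj.le)]
    have hR' : R m = (fun ω (i : Finset.Ico m N) => ζ i ω) ⁻¹' {t : Finset.Ico m N → ℂ |
        ‖∑ i ∈ Finset.Ico m N, if h : i ∈ Finset.Ico m N then t ⟨i, h⟩ else 0‖ ≤ a} := by
      ext ω
      simp only [hR, mem_ofPred_eq, mem_preimage]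
      rw [hval _ _ _ subset_rfl]
    rw [← hF', ← hR'] at this
    simp only [measureReal_def, this, ENNReal.toReal_mul]
  have hRc : ∀ m ≤ N, 1 - c ≤ P.real (R m) := by
    intro m hm
    have h1 := hc m hm
    have h2 : {ω | a < ‖∑ i ∈ Finset.Ico m N, ζ i ω‖} = (R m)ᶜ := by
      ext ω; simp [hR]
    rw [h2, probReal_compl_eq_one_sub (hRm m)] at h1
    linarith
  have hunion : {ω | ∃ m ≤ N, 2 * a < ‖∑ i ∈ Finset.range m, ζ i ω‖} =
      ⋃ m ∈ Finset.range (N + 1), F m := by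
    ext ω
    simp only [mem_ofPred_eq, mem_iUnion, Finset.mem_range, Nat.lt_succ_iff, exists_prop, hF]
    constructor
    · intro h
      classical
      obtain ⟨h1, h2⟩ := Nat.find_spec h
      refine ⟨Nat.find h, h1, h2, fun j hj => ?_⟩
      have := Nat.find_min h hj
      by_contra! h'
      exact this ⟨hj.le.trans h1, h'⟩
    · rintro ⟨m, hm, h, -⟩
      exact ⟨m, hm, h⟩
  have hsub : (⋃ m ∈ Finset.range (N + 1), F m ∩ R m) ⊆
      {ω | a < ‖∑ i ∈ Finset.range N, ζ i ω‖} := by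
    intro ω hω
    simp only [mem_iUnion, Finset.mem_range, Nat.lt_succ_iff, exists_prop] at hω
    obtain ⟨m, hm, ⟨h1, -⟩, h2⟩ := hω
    simp only [hR, mem_ofPred_eq] at h2 ⊢
    have h3 := Finset.sum_range_add_sum_Ico (fun i => ζ i ω) hm
    have h4 := norm_sub_le (∑ i ∈ Finset.range N, ζ i ω) (∑ i ∈ Finset.Ico m N, ζ i ω)
    rw [← h3, add_sub_cancel_right] at h4
    rw [← h3]
    linarith
  rw [hunion, measureReal_biUnion_finset (fun m _ n _ h => hdisj m n h) (fun m _ => hFm m),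
    Finset.mul_sum]
  refine le_trans ?_ (measureReal_mono hsub)
  rw [measureReal_biUnion_finset
    (fun m _ n _ h => (hdisj m n h).mono inter_subset_left inter_subset_left)
    (fun m _ => (hFm m).inter (hRm m))]
  refine Finset.sum_le_sum fun m hm => ?_
  have hm' : m ≤ N := Nat.lt_succ_iff.1 (Finset.mem_range.1 hm)
  rw [hindep m hm', mul_comm]
  exact mul_le_mul_of_nonneg_left (hRc m hm') measureReal_nonneg

end Maximal

/-! ### Tails of the stationary autoregression -/

section Autoregression

lemma tailDF_map_abs {Y : Ω → ℝ} (hY : Measurable Y) (a : ℝ) :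
    tailDF (Measure.map (fun ω => |Y ω|) ℙ) a = (ℙ : Measure Ω).real {ω | a < |Y ω|} := by
  rw [tailDF, Measure.map_apply (by fun_prop) measurableSet_Ioi]
  rfl

lemma measureReal_lt_abs_congr {X : ℤ → Ω → ℝ} (hX : ∀ i, Measurable (X i))
    (hid : ∀ i, Measure.map (X i) ℙ = Measure.map (X 1) (ℙ : Measure Ω)) (i : ℤ) (a : ℝ) :
    (ℙ : Measure Ω).real {ω | a < |X i ω|} = (ℙ : Measure Ω).real {ω | a < |X 1 ω|} := by
  have hs : MeasurableSet {x : ℝ | a < |x|} := measurableSet_lt measurable_const (by fun_prop)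
  have h1 := Measure.map_apply (μ := ℙ) (hX i) hs
  have h2 := Measure.map_apply (μ := ℙ) (hX 1) hs
  rw [hid i] at h1
  simp only [measureReal_def]
  exact congrArg ENNReal.toReal (h1.symm.trans h2)

lemma IsStationaryZ.map_eq {X : ℤ → Ω → ℝ} (h : IsStationaryZ X) (hX : ∀ i, Measurable (X i))
    (i : ℤ) : Measure.map (X i) ℙ = Measure.map (X 1) (ℙ : Measure Ω) := by
  have h1 := congrArg (Measure.map (fun x : ℤ → ℝ => x 1)) (h (i - 1))
  rw [Measure.map_map (measurable_pi_apply _) (measurable_pi_lambda _ fun j => hX _),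
    Measure.map_map (measurable_pi_apply _) (measurable_pi_lambda _ fun j => hX _)] at h1
  simpa [Function.comp_def] using h1

lemma measureReal_exists_lt_abs_le {X : ℤ → Ω → ℝ} (hX : ∀ i, Measurable (X i))
    (hid : ∀ i, Measure.map (X i) ℙ = Measure.map (X 1) (ℙ : Measure Ω))
    {ι : Type*} (s : Finset ι) (f : ι → ℤ) (a : ℝ) :
    (ℙ : Measure Ω).real {ω | ∃ j ∈ s, a < |X (f j) ω|} ≤
      s.card * (ℙ : Measure Ω).real {ω | a < |X 1 ω|} := by
  have hset : {ω | ∃ j ∈ s, a < |X (f j) ω|} = ⋃ j ∈ s, {ω | a < |X (f j) ω|} := by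
    ext ω; simp
  rw [hset]
  refine (measureReal_biUnion_finset_le s _).trans ?_
  simp only [measureReal_lt_abs_congr hX hid, Finset.sum_const, nsmul_eq_mul, le_refl]

variable [IsProbabilityMeasure (ℙ : Measure Ω)]

lemma tendsto_measureReal_lt_abs {Y : Ω → ℝ} (hY : Measurable Y) :
    Tendsto (fun a => (ℙ : Measure Ω).real {ω | a < |Y ω|}) atTop (nhds 0) := by
  have : IsProbabilityMeasure (Measure.map (fun ω => |Y ω|) (ℙ : Measure Ω)) :=
    Measure.isProbabilityMeasure_map (by fun_prop)
  exact (tendsto_tailDF_atTop (μ := Measure.map (fun ω => |Y ω|) (ℙ : Measure Ω))).congr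
    (tailDF_map_abs hY)

variable {p : ℕ} {φ : Fin p → ℝ} {X ξ : ℤ → Ω → ℝ}

/-- Stationarity with unbounded independent errors rules out unit roots. -/
lemma ne_zero_of_norm_le_one (hX : ∀ i, Measurable (X i)) (hξ : ∀ i, Measurable (ξ i))
    (hmodel : ∀ (i : ℤ) ω, X i ω = ∑ j : Fin p, φ j * X (i - ((j : ℕ) + 1)) ω + ξ i ω)
    (hchar : ∀ z : ℂ, ‖z‖ < 1 → (1 : ℂ) - ∑ j : Fin p, (φ j : ℂ) * z ^ ((j : ℕ) + 1) ≠ 0)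
    (hXid : ∀ i, Measure.map (X i) ℙ = Measure.map (X 1) (ℙ : Measure Ω))
    (hindep : iIndepFun ξ (ℙ : Measure Ω))
    (hξid : ∀ i, Measure.map (ξ i) ℙ = Measure.map (ξ 1) (ℙ : Measure Ω))
    (hpos : ∀ a, 0 < (ℙ : Measure Ω).real {ω | a < |ξ 1 ω|}) (z : ℂ) (hz : ‖z‖ ≤ 1) :
    (1 : ℂ) - ∑ j : Fin p, (φ j : ℂ) * z ^ ((j : ℕ) + 1) ≠ 0 := by
  intro hroot
  have hz1 : ‖z‖ = 1 := by
    rcases hz.lt_or_eq with h | h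
    · exact absurd hroot (hchar z h)
    · exact h
  have hz0 : z ≠ 0 := norm_ne_zero_iff.1 (by rw [hz1]; exact one_ne_zero)
  set φ' : ℕ → ℂ := fun l => if h : l < p then (φ ⟨l, h⟩ : ℂ) else 0
  set w : ℕ → ℂ := fun m => z⁻¹ ^ m * (1 - ∑ l ∈ Finset.range m, φ' l * z ^ (l + 1)) with hw
  have hw0 : w 0 = 1 := by simp [hw]
  have hwp : w p = 0 := by
    have : ∑ l ∈ Finset.range p, φ' l * z ^ (l + 1) =
        ∑ j : Fin p, (φ j : ℂ) * z ^ ((j : ℕ) + 1) := by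
      rw [Finset.sum_range]
      exact Finset.sum_congr rfl fun j _ => by simp [φ']
    rw [hw]
    simp only [this, hroot, mul_zero]
  have hwsucc : ∀ l, w (l + 1) = z⁻¹ * w l - φ' l := by
    intro l
    simp only [hw, Finset.sum_range_succ]
    have : z⁻¹ ^ (l + 1) * z ^ (l + 1) = 1 := by
      rw [← mul_pow, inv_mul_cancel₀ hz0, one_pow]
    linear_combination (-φ' l) * this
  set Y : ℤ → Ω → ℂ := fun i ω => ∑ l ∈ Finset.range p, w l * (X (i - l) ω : ℂ) with hY
  have hYrec : ∀ i ω, Y i ω = z⁻¹ * Y (i - 1) ω + (ξ i ω : ℂ) := by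
    intro i ω
    have h1 : Y i ω = (X i ω : ℂ) +
        ∑ l ∈ Finset.range p, w (l + 1) * (X (i - (l + 1)) ω : ℂ) := by
      have h2 := Finset.sum_range_succ (fun l : ℕ => w l * (X (i - l) ω : ℂ)) p
      rw [hwp, zero_mul, add_zero, Finset.sum_range_succ'] at h2
      simp only [hY]
      rw [← h2, hw0]
      push_cast
      simp only [sub_zero, one_mul]
      ring
    have h3 : (X i ω : ℂ) = ∑ l ∈ Finset.range p, φ' l * (X (i - (l + 1)) ω : ℂ) + ξ i ω := by
      rw [hmodel i ω, Finset.sum_range]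
      push_cast
      congr 1
      exact Finset.sum_congr rfl fun j _ => by simp [φ']
    rw [h1, h3]
    simp only [hY, Finset.mul_sum]
    rw [add_right_comm, ← Finset.sum_add_distrib]
    congr 1
    refine Finset.sum_congr rfl fun l _ => ?_
    rw [hwsucc, show i - 1 - (l : ℤ) = i - (l + 1) by ring]
    ring
  set U : ℕ → Ω → ℂ := fun m ω => z ^ m * Y m ω with hU
  set ζ : ℕ → Ω → ℂ := fun m ω => z ^ (m + 1) * (ξ ((m : ℤ) + 1) ω : ℂ) with hζ
  have hUrec : ∀ m ω, U (m + 1) ω = U m ω + ζ m ω := by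
    intro m ω
    simp only [hU, hζ]
    rw [hYrec]
    push_cast
    rw [add_sub_cancel_right, mul_add, pow_succ]
    field_simp
  have hsum : ∀ m N ω, m ≤ N → ∑ i ∈ Finset.Ico m N, ζ i ω = U N ω - U m ω := by
    intro m N ω hmN
    rw [← Finset.sum_Ico_sub (fun i => U i ω) hmN]
    refine Finset.sum_congr rfl fun i _ => ?_
    rw [hUrec]; ring
  have hζm : ∀ i, Measurable (ζ i) := fun i =>
    measurable_const.mul (Complex.measurable_ofReal.comp (hξ _))
  have hζind : iIndepFun ζ (ℙ : Measure Ω) := by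
    have h1 := hindep.precomp (g := fun m : ℕ => (m : ℤ) + 1)
      (fun a b h => by simpa using h)
    exact h1.comp (fun m x => z ^ (m + 1) * (x : ℂ))
      fun m => measurable_const.mul Complex.measurable_ofReal
  obtain ⟨T, hT⟩ := ((tendsto_measureReal_lt_abs (hX 1)).eventually_le_const
    (u := 1 / (8 * ((p : ℝ) + 1))) (by positivity)).exists
  set K : ℝ := ∑ l ∈ Finset.range p, ‖w l‖ * T
  have hUtight : ∀ m, (ℙ : Measure Ω).real {ω | K < ‖U m ω‖} ≤ 1 / 8 := by
    intro m
    refine (measureReal_mono (fun ω hω => ?_)).trans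
      ((measureReal_exists_lt_abs_le hX hXid (Finset.range p) (fun l => (m : ℤ) - l) T).trans ?_)
    · by_contra hcon
      simp only [mem_ofPred_eq, not_exists, not_and, not_lt] at hcon hω
      refine absurd hω (not_lt.2 ?_)
      simp only [hU, hY, norm_mul, norm_pow, hz1, one_pow, one_mul]
      refine (norm_sum_le _ _).trans (Finset.sum_le_sum fun l hl => ?_)
      rw [norm_mul, Complex.norm_real, Real.norm_eq_abs]
      exact mul_le_mul_of_nonneg_left (hcon l hl) (norm_nonneg _)
    · rw [Finset.card_range]
      calc (p : ℝ) * _ ≤ ((p : ℝ) + 1) * (1 / (8 * ((p : ℝ) + 1))) := by gcongr; linarith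
        _ = 1 / 8 := by field_simp
  have hinc : ∀ N, ∀ m ≤ N,
      (ℙ : Measure Ω).real {ω | 2 * K < ‖∑ i ∈ Finset.Ico m N, ζ i ω‖} ≤ 1 / 4 := by
    intro N m hm
    have hsub : {ω | 2 * K < ‖∑ i ∈ Finset.Ico m N, ζ i ω‖} ⊆
        {ω | K < ‖U N ω‖} ∪ {ω | K < ‖U m ω‖} := by
      intro ω hω
      by_contra hcon
      simp only [mem_union, mem_ofPred_eq, not_or, not_lt] at hcon hω
      rw [hsum m N ω hm] at hω
      linarith [norm_sub_le (U N ω) (U m ω)]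
    refine (measureReal_mono hsub).trans ((measureReal_union_le _ _).trans ?_)
    linarith [hUtight N, hUtight m]
  set q := (ℙ : Measure Ω).real {ω | 8 * K < |ξ 1 ω|}
  have hq : 0 < q := hpos _
  have hq1 : q ≤ 1 := measureReal_le_one
  have hall : ∀ N : ℕ, 2 / 3 ≤ (1 - q) ^ N := by
    intro N
    have hO := ottaviani hζm hζind N (hinc N)
    have h0 := hinc N 0 (Nat.zero_le _)
    rw [Nat.Ico_zero_eq_range] at h0
    have hsub : {ω | ∃ m ≤ N, 2 * (2 * K) < ‖∑ i ∈ Finset.range m, ζ i ω‖}ᶜ ⊆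
        ⋂ i ∈ Finset.range N, (fun ω => ξ ((i : ℤ) + 1) ω) ⁻¹' {x | |x| ≤ 8 * K} := by
      intro ω hω
      simp only [mem_compl_iff, mem_ofPred_eq, not_exists, not_and, not_lt] at hω
      simp only [mem_iInter, Finset.mem_range, mem_preimage, mem_ofPred_eq]
      intro i hi
      have h1 := hω i hi.le
      have h2 := hω (i + 1) hi
      rw [Finset.sum_range_succ] at h2
      have h3 := norm_sub_le (∑ j ∈ Finset.range i, ζ j ω + ζ i ω) (∑ j ∈ Finset.range i, ζ j ω)
      rw [add_sub_cancel_left] at h3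
      have h4 : ‖ζ i ω‖ = |ξ ((i : ℤ) + 1) ω| := by
        simp [hζ, hz1]
      linarith
    have hms : MeasurableSet {x : ℝ | |x| ≤ 8 * K} :=
      measurableSet_le (by fun_prop) measurable_const
    have hprod := (hindep.precomp (g := fun m : ℕ => (m : ℤ) + 1)
      (fun a b h => by simpa using h)).measure_inter_preimage_eq_mul (Finset.range N)
        (sets := fun _ => {x | |x| ≤ 8 * K}) (fun _ _ => hms)
    have hone : ∀ i : ℕ, (ℙ : Measure Ω).real
        ((fun ω => ξ ((i : ℤ) + 1) ω) ⁻¹' {x | |x| ≤ 8 * K}) = 1 - q := by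
      intro i
      have h1 : (fun ω => ξ ((i : ℤ) + 1) ω) ⁻¹' {x | |x| ≤ 8 * K} =
          {ω | 8 * K < |ξ ((i : ℤ) + 1) ω|}ᶜ := by ext ω; simp
      rw [h1, probReal_compl_eq_one_sub
        (measurableSet_lt measurable_const (hξ _).abs), measureReal_lt_abs_congr hξ hξid]
    have hprod' : (ℙ : Measure Ω).real
        (⋂ i ∈ Finset.range N, (fun ω => ξ ((i : ℤ) + 1) ω) ⁻¹' {x | |x| ≤ 8 * K}) =
        (1 - q) ^ N := by
      rw [measureReal_def]
      refine (congrArg ENNReal.toReal hprod).trans ?_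
      rw [ENNReal.toReal_prod]
      refine (Finset.prod_congr rfl fun i _ => hone i).trans ?_
      rw [Finset.prod_const, Finset.card_range]
    rw [← hprod']
    refine le_trans ?_ (measureReal_mono hsub)
    set G := {ω | ∃ m ≤ N, 2 * (2 * K) < ‖∑ i ∈ Finset.range m, ζ i ω‖}
    have hc := measureReal_union_le (μ := (ℙ : Measure Ω)) G Gᶜ
    rw [union_compl_self, probReal_univ] at hc
    linarith
  have hlim := tendsto_pow_atTop_nhds_zero_of_lt_one (sub_nonneg.2 hq1)
    (show 1 - q < 1 by linarith)
  obtain ⟨N, hN⟩ := (hlim.eventually_lt_const (u := 2 / 3) (by norm_num)).exists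
  exact absurd (hall N) (not_le.2 hN)

/-- The tail of the autoregression is dominated by the tail of the errors. -/
lemma exists_tail_bound (hX : ∀ i, Measurable (X i)) (hξ : ∀ i, Measurable (ξ i))
    (hmodel : ∀ (i : ℤ) ω, X i ω = ∑ j : Fin p, φ j * X (i - ((j : ℕ) + 1)) ω + ξ i ω)
    (hchar : ∀ z : ℂ, ‖z‖ < 1 → (1 : ℂ) - ∑ j : Fin p, (φ j : ℂ) * z ^ ((j : ℕ) + 1) ≠ 0)
    (hXid : ∀ i, Measure.map (X i) ℙ = Measure.map (X 1) (ℙ : Measure Ω))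
    (hindep : iIndepFun ξ (ℙ : Measure Ω))
    (hξid : ∀ i, Measure.map (ξ i) ℙ = Measure.map (ξ 1) (ℙ : Measure Ω))
    {α : ℝ} (hα : 0 < α) {l : ℝ → ℝ} (hp : 0 < p)
    (htail : ParetoTail (Measure.map (fun ω => |ξ 1 ω|) (ℙ : Measure Ω)) α l) :
    ∃ M B x₀ : ℝ, 0 < M ∧ 0 < B ∧ ∀ x, x₀ ≤ x → (ℙ : Measure Ω).real {ω | M * x < |X 1 ω|} ≤
      B * tailDF (Measure.map (fun ω => |ξ 1 ω|) (ℙ : Measure Ω)) x := by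
  set μ := Measure.map (fun ω => |ξ 1 ω|) (ℙ : Measure Ω)
  have : IsProbabilityMeasure μ := Measure.isProbabilityMeasure_map (hξ 1).abs.aemeasurable
  have hμ : ∀ a, tailDF μ a = (ℙ : Measure Ω).real {ω | a < |ξ 1 ω|} := tailDF_map_abs (hξ 1)
  obtain ⟨C, r, hC, hr, hr1, hMA⟩ := exists_moving_average_bound hp φ
    (ne_zero_of_norm_le_one hX hξ hmodel hchar hXid hindep hξid fun a => hμ a ▸ htail.pos a)
  set δ := Real.sqrt r
  have hδ : 0 < δ := Real.sqrt_pos.2 hr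
  have hδ1 : δ < 1 := by
    rw [← Real.sqrt_one]
    exact Real.sqrt_lt_sqrt hr.le hr1
  have hδr : δ * δ = r := Real.mul_self_sqrt hr.le
  obtain ⟨q, x₀, hq, hq1, hx₀, hgeo⟩ := htail.exists_geometric_bound hα (one_lt_inv₀ hδ |>.2 hδ1)
  refine ⟨C * (1 - δ)⁻¹ + 1, (1 - q)⁻¹, x₀, ?_, inv_pos.2 (sub_pos.2 hq1), fun x hx => ?_⟩
  · have := inv_pos.2 (sub_pos.2 hδ1); positivity
  have hx0 : 0 < x := hx₀.trans_le hx
  have hp' : (0 : ℝ) < p := Nat.cast_pos.2 hp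
  set a : ℕ → ℝ := fun N => x / (p * C) * (r ^ N)⁻¹ with ha
  have hbound : ∀ N : ℕ,
      (ℙ : Measure Ω).real {ω | (C * (1 - δ)⁻¹ + 1) * x < |X 1 ω|} ≤
        (1 - q)⁻¹ * tailDF μ x + p * (ℙ : Measure Ω).real {ω | a N < |X 1 ω|} := by
    intro N
    have hsub : {ω | (C * (1 - δ)⁻¹ + 1) * x < |X 1 ω|} ⊆
        (⋃ j ∈ Finset.range N, {ω | δ⁻¹ ^ j * x < |ξ (1 - (j : ℤ)) ω|}) ∪
        {ω | ∃ j ∈ (Finset.univ : Finset (Fin p)), a N < |X (1 - N - (j : ℕ)) ω|} := by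
      intro ω hω
      by_contra hcon
      simp only [mem_union, mem_iUnion, mem_ofPred_eq, not_or, not_exists, not_and, not_lt,
        exists_prop, Finset.mem_range, Finset.mem_univ, true_and] at hcon hω
      obtain ⟨h1, h2⟩ := hcon
      refine absurd hω (not_lt.2 ((hMA (fun i => X i ω) (fun i => ξ i ω)
        (fun i => hmodel i ω) 1 N).trans ?_))
      rw [add_mul, one_mul]
      refine add_le_add ?_ ?_
      · have hgs : ∑ j ∈ Finset.range N, δ ^ j ≤ (1 - δ)⁻¹ := by
          have := (summable_geometric_of_lt_one hδ.le hδ1).sum_le_tsum (Finset.range N)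
            fun j _ => pow_nonneg hδ.le j
          rwa [tsum_geometric_of_lt_one hδ.le hδ1] at this
        calc _ ≤ ∑ j ∈ Finset.range N, C * x * δ ^ j := by
              refine Finset.sum_le_sum fun j hj => ?_
              have h3 := h1 j (Finset.mem_range.1 hj)
              calc C * r ^ j * |ξ (1 - (j : ℤ)) ω| ≤ C * r ^ j * (δ⁻¹ ^ j * x) := by gcongr
                _ = C * x * δ ^ j := by
                  rw [← hδr, mul_pow, inv_pow]
                  field_simp
          _ = C * x * ∑ j ∈ Finset.range N, δ ^ j := by rw [Finset.mul_sum]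
          _ ≤ C * x * (1 - δ)⁻¹ := by gcongr
          _ = _ := by ring
      · calc _ ≤ C * r ^ N * ∑ j : Fin p, a N := by
              gcongr with j
              exact h2 j
          _ = x := by
              rw [Finset.sum_const, Finset.card_univ, Fintype.card_fin, nsmul_eq_mul, ha]
              field_simp
    refine (measureReal_mono hsub).trans ((measureReal_union_le _ _).trans (add_le_add ?_ ?_))
    · refine (measureReal_biUnion_finset_le _ _).trans ?_
      have hgs : ∑ j ∈ Finset.range N, q ^ j ≤ (1 - q)⁻¹ := by
        have := (summable_geometric_of_lt_one hq.le hq1).sum_le_tsum (Finset.range N)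
          fun j _ => pow_nonneg hq.le j
        rwa [tsum_geometric_of_lt_one hq.le hq1] at this
      calc _ ≤ ∑ j ∈ Finset.range N, q ^ j * tailDF μ x := by
            refine Finset.sum_le_sum fun j _ => ?_
            rw [measureReal_lt_abs_congr hξ hξid, ← hμ]
            exact hgeo x hx j
        _ = (∑ j ∈ Finset.range N, q ^ j) * tailDF μ x := by rw [Finset.sum_mul]
        _ ≤ _ := mul_le_mul_of_nonneg_right hgs (tailDF_nonneg x)
    · have := measureReal_exists_lt_abs_le hX hXid (Finset.univ : Finset (Fin p))
        (fun j => 1 - (N : ℤ) - (j : ℕ)) (a N)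
      rwa [Finset.card_univ, Fintype.card_fin] at this
  have ha_lim : Tendsto a atTop atTop := by
    refine Tendsto.const_mul_atTop (by positivity) ?_
    refine Tendsto.inv_tendsto_nhdsGT_zero (tendsto_nhdsWithin_iff.2
      ⟨tendsto_pow_atTop_nhds_zero_of_lt_one hr.le hr1, ?_⟩)
    exact Eventually.of_forall fun N => pow_pos hr N
  have hlim := (((tendsto_measureReal_lt_abs (hX 1)).comp ha_lim).const_mul (p : ℝ)).const_add
    ((1 - q)⁻¹ * tailDF μ x)
  rw [mul_zero, add_zero] at hlim
  exact ge_of_tendsto' hlim hbound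

end Autoregression

/-! ### Tail probabilities near the quantile -/

section NearQuantile

lemma exp_neg_le_one_sub_half {x : ℝ} (h0 : 0 ≤ x) (h1 : x ≤ 1) : Real.exp (-x) ≤ 1 - x / 2 := by
  have h2 : Real.exp (-x) ≤ (1 + x)⁻¹ := by
    rw [Real.exp_neg]
    exact inv_anti₀ (by positivity) (by linarith [Real.add_one_le_exp x])
  refine h2.trans ?_
  rw [inv_le_iff_one_le_mul₀ (by positivity)]
  nlinarith

lemma TailFraction.eventually_pos {k : ℕ → ℕ} (hk : TailFraction k) :
    ∀ᶠ n : ℕ in atTop, 0 < k n := by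
  filter_upwards [hk.1.eventually_gt_atTop 0] with n hn
  exact_mod_cast hn

lemma TailFraction.eventually_lt {k : ℕ → ℕ} (hk : TailFraction k) :
    ∀ᶠ n : ℕ in atTop, k n < n := by
  filter_upwards [hk.2.eventually_lt_const one_pos, eventually_gt_atTop 0] with n hn hn0
  rw [div_lt_one (by exact_mod_cast hn0)] at hn
  exact_mod_cast hn

lemma TailFraction.tendsto_div {k : ℕ → ℕ} (hk : TailFraction k) :
    Tendsto (fun n : ℕ => (n : ℝ) / k n) atTop atTop := by
  have h : Tendsto (fun n : ℕ => (k n : ℝ) / n) atTop (nhdsWithin 0 (Ioi 0)) := by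
    refine tendsto_nhdsWithin_iff.2 ⟨hk.2, ?_⟩
    filter_upwards [hk.eventually_pos, eventually_gt_atTop 0] with n h1 h2
    have h1' : (0 : ℝ) < k n := by exact_mod_cast h1
    have h2' : (0 : ℝ) < n := by exact_mod_cast h2
    exact div_pos h1' h2'
  exact h.inv_tendsto_nhdsGT_zero.congr fun n => inv_div _ _

lemma TailFraction.tendsto_sqrt {k : ℕ → ℕ} (hk : TailFraction k) :
    Tendsto (fun n : ℕ => Real.sqrt (k n)) atTop atTop :=
  Real.tendsto_sqrt_atTop.comp hk.1

lemma TailFraction.tendsto_inv_sqrt {k : ℕ → ℕ} (hk : TailFraction k) :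
    Tendsto (fun n : ℕ => (Real.sqrt (k n))⁻¹) atTop (nhds 0) :=
  tendsto_inv_atTop_zero.comp hk.tendsto_sqrt

lemma TailFraction.tendsto_div_sqrt {k : ℕ → ℕ} (hk : TailFraction k) :
    Tendsto (fun n : ℕ => (n : ℝ) / Real.sqrt (k n)) atTop atTop := by
  refine tendsto_atTop_mono' _ ?_ hk.tendsto_div
  filter_upwards [hk.eventually_pos] with n hn
  have h1 : (1 : ℝ) ≤ k n := by exact_mod_cast hn
  have h2 : Real.sqrt (k n) ≤ k n := by
    rw [Real.sqrt_le_left (by positivity)]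
    nlinarith
  exact div_le_div_of_nonneg_left (by positivity) (Real.sqrt_pos.2 (by linarith)) h2

variable {μ : Measure ℝ} [IsProbabilityMeasure μ] {α : ℝ} {l g : ℝ → ℝ} {K γ : ℝ} {k : ℕ → ℕ}

/-- Along the quantiles, the ratios of the slowly varying part are `1 + o(k^{-1/2})`, uniformly on
neighbourhoods shrinking to one. -/
lemma ParetoTail.eventually_slow_ratio (h : ParetoTail μ α l) (h2 : SecondOrderRV l g K γ)
    (hk : TailFraction k)
    (h3 : Tendsto (fun n : ℕ => Real.sqrt (k n) * g (quantileB μ ((n : ℝ) / k n))) atTop (nhds 0))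
    (c : ℝ) :
    ∀ᶠ n : ℕ in atTop, 0 < quantileB μ ((n : ℝ) / k n) ∧
      ∃ ρ, |ρ - 1| ≤ (Real.sqrt (k n))⁻¹ ∧
        tailDF μ (Real.exp (c * (Real.sqrt (k n))⁻¹) * quantileB μ ((n : ℝ) / k n)) =
          Real.exp (-(α * c * (Real.sqrt (k n))⁻¹)) * ρ *
            tailDF μ (quantileB μ ((n : ℝ) / k n)) := by
  obtain ⟨η, D, x₀, hη, hD, hbd⟩ := h.exists_locally_uniform_bound h2
  have hu := (tendsto_quantileB h.pos).comp hk.tendsto_div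
  have hs := (hk.tendsto_inv_sqrt.const_mul c).abs
  rw [mul_zero, abs_zero] at hs
  have h3' := h3.const_mul D
  rw [mul_zero] at h3'
  filter_upwards [hu.eventually_ge_atTop x₀, hu.eventually_gt_atTop 0, hs.eventually_le_const hη,
    h3'.eventually_le_const one_pos, hk.eventually_pos] with n hn1 hn2 hn3 hn4 hn5
  simp only [Function.comp_apply] at hn1 hn2
  have hsq : 0 < Real.sqrt (k n) := Real.sqrt_pos.2 (by exact_mod_cast hn5)
  refine ⟨hn2, l (Real.exp (c * (Real.sqrt (k n))⁻¹) * quantileB μ ((n : ℝ) / k n)) /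
    l (quantileB μ ((n : ℝ) / k n)), ?_, ?_⟩
  rotate_left
  · rw [h.tailDF_mul (Real.exp_pos _) hn2, ← Real.exp_mul]
    congr 3
    ring
  · refine (hbd _ hn1 _ hn3).trans ?_
    rw [← mul_one (Real.sqrt (k n))⁻¹, ← div_eq_inv_mul, le_div_iff₀ hsq]
    linarith

lemma ParetoTail.exists_upper_perturbation (h : ParetoTail μ α l) (hα : 0 < α)
    (h2 : SecondOrderRV l g K γ) (hk : TailFraction k)
    (h3 : Tendsto (fun n : ℕ => Real.sqrt (k n) * g (quantileB μ ((n : ℝ) / k n))) atTop (nhds 0))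
    {L : ℝ} (hL : 0 < L) :
    ∃ c : ℝ, 0 < c ∧ ∀ᶠ n : ℕ in atTop,
      n * tailDF μ (Real.exp (c * (Real.sqrt (k n))⁻¹) * quantileB μ ((n : ℝ) / k n)) ≤
        k n - L * Real.sqrt (k n) := by
  refine ⟨(2 * L + 1) / α, by positivity, ?_⟩
  have hs := hk.tendsto_inv_sqrt.const_mul (2 * L)
  rw [mul_zero] at hs
  filter_upwards [h.eventually_slow_ratio h2 hk h3 ((2 * L + 1) / α), hk.eventually_pos,
    hs.eventually_le_const one_pos, hk.tendsto_div.eventually_gt_atTop 1,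
    eventually_gt_atTop 0] with n ⟨hu, ρ, hρ, heq⟩ hkn hsn hnk hn
  have hk0 : (0 : ℝ) < k n := by exact_mod_cast hkn
  have hn0 : (0 : ℝ) < n := by exact_mod_cast hn
  set r := Real.sqrt (k n)
  have hr : 0 < r := Real.sqrt_pos.2 hk0
  have hkr : (k n : ℝ) = r * r := (Real.mul_self_sqrt hk0.le).symm
  have hq := tailDF_quantileB_le (μ := μ) hnk
  rw [inv_div, le_div_iff₀ hn0] at hq
  have hρ' : ρ ≤ Real.exp r⁻¹ := by
    linarith [(abs_le.1 hρ).2, Real.add_one_le_exp r⁻¹]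
  rw [heq, mul_div_cancel₀ _ hα.ne']
  have hexp : Real.exp (-((2 * L + 1) * r⁻¹)) * Real.exp r⁻¹ ≤ 1 - L * r⁻¹ := by
    rw [← Real.exp_add, show -((2 * L + 1) * r⁻¹) + r⁻¹ = -(2 * L * r⁻¹) by ring]
    refine (exp_neg_le_one_sub_half (by positivity) hsn).trans (le_of_eq (by ring))
  calc (n : ℝ) * (Real.exp (-((2 * L + 1) * r⁻¹)) * ρ * tailDF μ (quantileB μ (n / k n)))
      = Real.exp (-((2 * L + 1) * r⁻¹)) * ρ * (tailDF μ (quantileB μ (n / k n)) * n) := by ring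
    _ ≤ Real.exp (-((2 * L + 1) * r⁻¹)) * Real.exp r⁻¹ *
        (tailDF μ (quantileB μ (n / k n)) * n) := by
      have := tailDF_nonneg (μ := μ) (quantileB μ (n / k n))
      gcongr
    _ ≤ Real.exp (-((2 * L + 1) * r⁻¹)) * Real.exp r⁻¹ * k n := by gcongr
    _ ≤ (1 - L * r⁻¹) * k n := by gcongr
    _ = k n - L * r := by rw [hkr]; field_simp

lemma ParetoTail.exists_lower_perturbation (h : ParetoTail μ α l) (hα : 0 < α)
    (hμ : μ (Iio 0) = 0) (h2 : SecondOrderRV l g K γ) (hk : TailFraction k)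
    (h3 : Tendsto (fun n : ℕ => Real.sqrt (k n) * g (quantileB μ ((n : ℝ) / k n))) atTop (nhds 0))
    {L : ℝ} (hL : 0 < L) :
    ∃ c : ℝ, 0 < c ∧ ∀ᶠ n : ℕ in atTop,
      k n + L * Real.sqrt (k n) ≤
        n * tailDF μ (Real.exp (-c * (Real.sqrt (k n))⁻¹) * quantileB μ ((n : ℝ) / k n)) ∧
      n * tailDF μ (Real.exp (-c * (Real.sqrt (k n))⁻¹) * quantileB μ ((n : ℝ) / k n)) ≤
        2 * k n := by
  set c := 1 + (L + 3) / α with hc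
  refine ⟨c, by positivity, ?_⟩
  have hs1 := ((hk.tendsto_inv_sqrt.const_mul (α * c + 1)).rexp)
  rw [mul_zero, Real.exp_zero] at hs1
  filter_upwards [h.eventually_slow_ratio h2 hk h3 (-c), h.eventually_slow_ratio h2 hk h3 (-1),
    hk.eventually_pos, hk.tendsto_inv_sqrt.eventually_le_const (u := 1 / 2) (by norm_num),
    hs1.eventually_le_const one_lt_two, hk.tendsto_div.eventually_gt_atTop 1,
    eventually_gt_atTop 0] with n ⟨hu, ρ, hρ, heq⟩ ⟨_, ρ', hρ', heq'⟩ hkn hsn hsn1 hnk hn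
  have hk0 : (0 : ℝ) < k n := by exact_mod_cast hkn
  have hn0 : (0 : ℝ) < n := by exact_mod_cast hn
  set r := Real.sqrt (k n)
  have hr : 0 < r := Real.sqrt_pos.2 hk0
  have hkr : (k n : ℝ) = r * r := (Real.mul_self_sqrt hk0.le).symm
  have hr' : 0 < r⁻¹ := inv_pos.2 hr
  set u := quantileB μ ((n : ℝ) / k n)
  have hq : tailDF μ u ≤ k n / n := by simpa using tailDF_quantileB_le (μ := μ) hnk
  have hq' : (k n : ℝ) / n < tailDF μ (Real.exp (-1 * r⁻¹) * u) := by
    have := lt_tailDF_of_lt_quantileB hμ hnk (x := Real.exp (-1 * r⁻¹) * u)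
      (mul_lt_of_lt_one_left hu (Real.exp_lt_one_iff.2 (by linarith)))
    simpa using this
  rw [le_div_iff₀ hn0] at hq
  rw [div_lt_iff₀ hn0, heq'] at hq'
  have hu0 := tailDF_nonneg (μ := μ) u
  have h1 : ρ ≤ Real.exp r⁻¹ := by linarith [(abs_le.1 hρ).2, Real.add_one_le_exp r⁻¹]
  have h1' : ρ' ≤ Real.exp r⁻¹ := by linarith [(abs_le.1 hρ').2, Real.add_one_le_exp r⁻¹]
  have h2' : Real.exp (-(2 * r⁻¹)) ≤ ρ := by
    have := exp_neg_le_one_sub_half (x := 2 * r⁻¹) (by positivity) (by linarith)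
    linarith [(abs_le.1 hρ).1]
  rw [heq]
  have e1 : -(α * -c * r⁻¹) = α * c * r⁻¹ := by ring
  have e2 : -(α * -1 * r⁻¹) = α * r⁻¹ := by ring
  rw [e1]
  rw [e2] at hq'
  constructor
  · have hexp : Real.exp (α * c * r⁻¹) * Real.exp (-(2 * r⁻¹)) =
        Real.exp (L * r⁻¹) * (Real.exp (α * r⁻¹) * Real.exp r⁻¹) := by
      simp only [← Real.exp_add]
      congr 1
      rw [hc]
      field_simp
      ring
    calc k n + L * r = (1 + L * r⁻¹) * k n := by rw [hkr]; field_simp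
      _ ≤ Real.exp (L * r⁻¹) * k n := by
        gcongr
        linarith [Real.add_one_le_exp (L * r⁻¹)]
      _ ≤ Real.exp (L * r⁻¹) * (Real.exp (α * r⁻¹) * ρ' * tailDF μ u * n) := by gcongr
      _ ≤ Real.exp (L * r⁻¹) * (Real.exp (α * r⁻¹) * Real.exp r⁻¹ * tailDF μ u * n) := by gcongr
      _ = Real.exp (α * c * r⁻¹) * Real.exp (-(2 * r⁻¹)) * tailDF μ u * n := by
        rw [hexp]; ring
      _ ≤ Real.exp (α * c * r⁻¹) * ρ * tailDF μ u * n := by gcongr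
      _ = _ := by ring
  · calc n * (Real.exp (α * c * r⁻¹) * ρ * tailDF μ u)
        ≤ n * (Real.exp (α * c * r⁻¹) * Real.exp r⁻¹ * tailDF μ u) := by gcongr
      _ = Real.exp ((α * c + 1) * r⁻¹) * (tailDF μ u * n) := by
        rw [← Real.exp_add, add_mul, one_mul]; ring
      _ ≤ 2 * k n := by gcongr

end NearQuantile

/-! ### Exceedance counts and order statistics -/

section Counting

lemma orderStat_le {Ω' : Type*} {n k : ℕ} {Z : ℕ → Ω' → ℝ} {ω : Ω'} {x : ℝ} (hkn : k ≤ n)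
    (hZ : ∀ i, 0 ≤ Z i ω) (h : ((Finset.Icc 1 n).filter fun i => x < Z i ω).card < k) :
    orderStat n k Z ω ≤ x := by
  refine csInf_le ⟨0, fun y hy => ?_⟩ h
  by_contra! hy0
  have hall : ((Finset.Icc 1 n).filter fun i => y < Z i ω) = Finset.Icc 1 n :=
    Finset.filter_true_of_mem fun i _ => hy0.trans_le (hZ i)
  simp only [mem_ofPred_eq, hall, Nat.card_Icc] at hy
  omega

lemma le_orderStat {Ω' : Type*} {n k : ℕ} {Z : ℕ → Ω' → ℝ} {ω : Ω'} {x : ℝ} (hk : 0 < k)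
    (hZ : ∀ i, 0 ≤ Z i ω) (h : k ≤ ((Finset.Icc 1 n).filter fun i => x < Z i ω).card) :
    x ≤ orderStat n k Z ω := by
  refine le_csInf ⟨∑ i ∈ Finset.Icc 1 n, Z i ω, ?_⟩ fun y hy => ?_
  · have hnone : ((Finset.Icc 1 n).filter fun i => ∑ j ∈ Finset.Icc 1 n, Z j ω < Z i ω) = ∅ :=
      Finset.filter_false_of_mem fun i hi => not_lt.2
        (Finset.single_le_sum (f := fun i => Z i ω) (fun i _ => hZ i) hi)
    simpa [hnone] using hk
  · by_contra! hyx
    have hsub : ((Finset.Icc 1 n).filter fun i => x < Z i ω) ⊆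
        (Finset.Icc 1 n).filter fun i => y < Z i ω :=
      Finset.monotone_filter_right _ fun i _ hi => hyx.trans hi
    exact absurd (h.trans (Finset.card_le_card hsub)) (not_le.2 hy)

lemma card_filter_le_add {ι : Type*} (s : Finset ι) (P Q R : ι → Prop) [DecidablePred P]
    [DecidablePred Q] [DecidablePred R] (h : ∀ i ∈ s, P i → Q i ∨ R i) :
    (s.filter P).card ≤ (s.filter Q).card + (s.filter R).card := by
  classical
  refine (Finset.card_le_card (t := s.filter Q ∪ s.filter R) fun i hi => ?_).trans
    (Finset.card_union_le _ _)
  simp only [Finset.mem_filter, Finset.mem_union] at hi ⊢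
  rcases h i hi.1 hi.2 with h | h
  · exact Or.inl ⟨hi.1, h⟩
  · exact Or.inr ⟨hi.1, h⟩

variable [IsProbabilityMeasure (ℙ : Measure Ω)]

/-- Markov's inequality for the number of events that occur. -/
lemma measureReal_card_filter_le {ι : Type*} (s : Finset ι) {S : ι → Set Ω}
    [∀ i, DecidablePred (· ∈ S i)]
    (hS : ∀ i, MeasurableSet (S i)) {a b : ℝ} (ha : 0 < a)
    (hb : ∀ i ∈ s, (ℙ : Measure Ω).real (S i) ≤ b) :
    (ℙ : Measure Ω).real {ω | a ≤ ((s.filter fun i => ω ∈ S i).card : ℝ)} ≤ s.card * b / a := by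
  have hcard : ∀ ω, ((s.filter fun i => ω ∈ S i).card : ℝ) =
      ∑ i ∈ s, (S i).indicator (fun _ => (1 : ℝ)) ω := by
    intro ω
    rw [Finset.card_filter]
    push_cast
    exact Finset.sum_congr rfl fun i _ => by simp [indicator_apply]
  have hint : ∀ i ∈ s, Integrable ((S i).indicator fun _ => (1 : ℝ)) (ℙ : Measure Ω) :=
    fun i _ => (integrable_const 1).indicator (hS i)
  have hM := mul_meas_ge_le_integral_of_nonneg (μ := (ℙ : Measure Ω))
    (f := fun ω => ∑ i ∈ s, (S i).indicator (fun _ => (1 : ℝ)) ω)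
    (Eventually.of_forall fun ω => Finset.sum_nonneg fun i _ =>
      indicator_nonneg (fun _ _ => zero_le_one) ω) (integrable_finsetSum s hint) a
  rw [integral_finsetSum s hint] at hM
  simp only [hcard]
  rw [le_div_iff₀ ha, mul_comm]
  refine hM.trans ?_
  rw [← nsmul_eq_mul]
  refine Finset.sum_le_card_nsmul s _ b fun i hi => ?_
  rw [integral_indicator_const _ (hS i), smul_eq_mul, mul_one]
  exact hb i hi

/-- Chebyshev's inequality for the number of exceedances among i.i.d. variables. -/
lemma measureReal_exceedance_deviation_le {ξ : ℤ → Ω → ℝ} (hξ : ∀ i, Measurable (ξ i))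
    (hindep : iIndepFun ξ (ℙ : Measure Ω))
    (hid : ∀ i, Measure.map (ξ i) ℙ = Measure.map (ξ 1) (ℙ : Measure Ω))
    (n : ℕ) (v : ℝ) {a : ℝ} (ha : 0 < a) :
    (ℙ : Measure Ω).real {ω | a ≤ |(((Finset.Icc 1 n).filter fun i : ℕ =>
      v < |ξ i ω|).card : ℝ) - n * tailDF (Measure.map (fun ω => |ξ 1 ω|) ℙ) v|} ≤
      n * tailDF (Measure.map (fun ω => |ξ 1 ω|) (ℙ : Measure Ω)) v / a ^ 2 := by
  set t := tailDF (Measure.map (fun ω => |ξ 1 ω|) (ℙ : Measure Ω)) v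
  set f : ℝ → ℝ := {x : ℝ | v < |x|}.indicator fun _ => 1 with hf
  have hms : MeasurableSet {x : ℝ | v < |x|} := measurableSet_lt measurable_const (by fun_prop)
  have hfm : Measurable f := measurable_const.indicator hms
  set Y : ℕ → Ω → ℝ := fun i ω => f (ξ i ω) with hY
  have hYeq : ∀ i, Y i = {ω | v < |ξ i ω|}.indicator fun _ => 1 := fun i => by
    ext ω; simp [hY, hf, indicator_apply]
  have hYms : ∀ i : ℕ, MeasurableSet {ω | v < |ξ i ω|} := fun i =>
    measurableSet_lt measurable_const (hξ i).abs
  have hYint : ∀ i, ∫ ω, Y i ω = t := by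
    intro i
    rw [hYeq, integral_indicator_const _ (hYms i), smul_eq_mul, mul_one,
      measureReal_lt_abs_congr hξ hid, ← tailDF_map_abs (hξ 1)]
  have hYmem : ∀ i, MemLp (Y i) 2 (ℙ : Measure Ω) := by
    intro i
    rw [hYeq]
    exact memLp_indicator_const 2 (hYms i) 1 (Or.inr (measure_ne_top _ _))
  have hYvar : ∀ i, variance (Y i) (ℙ : Measure Ω) ≤ t := by
    intro i
    refine (variance_le_expectation_sq (hYmem i).1).trans (le_of_eq ?_)
    rw [← hYint i]
    refine integral_congr_ae (Eventually.of_forall fun ω => ?_)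
    simp only [Pi.pow_apply, hYeq, indicator_apply]
    split_ifs <;> simp
  have hYind : Set.Pairwise (Finset.Icc 1 n : Finset ℕ) fun i j => IndepFun (Y i) (Y j) ℙ := by
    intro i _ j _ hij
    exact (hindep.indepFun (by exact_mod_cast hij : (i : ℤ) ≠ j)).comp hfm hfm
  have hsum : ∀ ω, (∑ i ∈ Finset.Icc 1 n, Y i) ω =
      (((Finset.Icc 1 n).filter fun i : ℕ => v < |ξ i ω|).card : ℝ) := by
    intro ω
    rw [Finset.card_filter, Finset.sum_apply]
    push_cast
    exact Finset.sum_congr rfl fun i _ => by simp [hYeq, indicator_apply]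
  have hE : ∫ ω, (∑ i ∈ Finset.Icc 1 n, Y i) ω = n * t := by
    simp only [Finset.sum_apply]
    rw [integral_finsetSum _ fun i _ => (hYmem i).integrable one_le_two]
    simp [hYint]
  have hC := meas_ge_le_variance_div_sq
    (memLp_finsetSum' (Finset.Icc 1 n) fun i _ => hYmem i) ha
  rw [hE, IndepFun.variance_sum (fun i _ => hYmem i) hYind] at hC
  simp only [hsum] at hC
  refine (ENNReal.toReal_le_of_le_ofReal (div_nonneg (Finset.sum_nonneg fun i _ =>
    variance_nonneg _ _) (sq_nonneg a)) hC).trans ?_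
  gcongr
  refine (Finset.sum_le_card_nsmul _ _ t fun i _ => hYvar i).trans (le_of_eq ?_)
  simp

end Counting

/-! ### Order statistics of the absolute residuals -/

section Residuals

lemma exp_mul_add_le {c C s : ℝ} (hc : 0 ≤ c) (hs : 0 ≤ s) (hC : c + 1 ≤ C) :
    Real.exp (c * s) + s ≤ Real.exp (C * s) := by
  have h1 : 1 ≤ Real.exp (c * s) := Real.one_le_exp (by positivity)
  calc Real.exp (c * s) + s ≤ Real.exp (c * s) * (s + 1) := by nlinarith
    _ ≤ Real.exp (c * s) * Real.exp s := by gcongr; exact Real.add_one_le_exp s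
    _ = Real.exp ((c + 1) * s) := by rw [← Real.exp_add]; ring_nf
    _ ≤ Real.exp (C * s) := by gcongr

lemma exp_neg_mul_add_le {c C s : ℝ} (hs : 0 ≤ s) (hC : c + 2 ≤ C)
    (hhalf : 1 / 2 ≤ Real.exp (-C * s)) :
    Real.exp (-C * s) + s ≤ Real.exp (-c * s) := by
  calc Real.exp (-C * s) + s ≤ Real.exp (-C * s) * (2 * s + 1) := by nlinarith
    _ ≤ Real.exp (-C * s) * Real.exp (2 * s) := by gcongr; exact Real.add_one_le_exp (2 * s)
    _ = Real.exp ((-C + 2) * s) := by rw [← Real.exp_add]; ring_nf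
    _ ≤ Real.exp (-c * s) := by gcongr; linarith

/-- If all but a few of the `W i` are close to the `Z i`, and the exceedance counts of the `Z i`
at levels slightly above and slightly below `u` differ enough from `k`, then the `k`-th largest
`W i` is close to `u`. -/
lemma abs_sqrt_mul_log_orderStat_le {Ω' : Type*} {n k : ℕ} {Z W : ℕ → Ω' → ℝ} {ω : Ω'}
    {bad : ℕ → Prop} [DecidablePred bad] {u c₁ c₂ C K L m₁ m₂ : ℝ} (hk : 0 < k) (hkn : k ≤ n)
    (hu : 0 < u) (hc₁ : 0 ≤ c₁) (hC₁ : c₁ + 1 ≤ C) (hC₂ : c₂ + 2 ≤ C)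
    (hhalf : 1 / 2 ≤ Real.exp (-C * (Real.sqrt k)⁻¹)) (hW : ∀ i, 0 ≤ W i ω)
    (hWZ : ∀ i, ¬ bad i → |W i ω - Z i ω| ≤ u * (Real.sqrt k)⁻¹)
    (hbad : (((Finset.Icc 1 n).filter bad).card : ℝ) < K * Real.sqrt k)
    (h₁ : |(((Finset.Icc 1 n).filter fun i =>
      Real.exp (c₁ * (Real.sqrt k)⁻¹) * u < Z i ω).card : ℝ) - m₁| < L * Real.sqrt k)
    (hm₁ : m₁ ≤ k - (K + L) * Real.sqrt k)
    (h₂ : |(((Finset.Icc 1 n).filter fun i =>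
      Real.exp (-c₂ * (Real.sqrt k)⁻¹) * u < Z i ω).card : ℝ) - m₂| < L * Real.sqrt k)
    (hm₂ : k + (K + L) * Real.sqrt k ≤ m₂) :
    |Real.sqrt k * (Real.log (orderStat n k W ω) - Real.log u)| ≤ C := by
  have hr : 0 < Real.sqrt k := Real.sqrt_pos.2 (by exact_mod_cast hk)
  set r := Real.sqrt k
  have hs : 0 ≤ r⁻¹ := by positivity
  have hup : orderStat n k W ω ≤ Real.exp (C * r⁻¹) * u := by
    refine orderStat_le hkn hW ?_
    have hcard := card_filter_le_add (Finset.Icc 1 n)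
      (fun i => Real.exp (C * r⁻¹) * u < W i ω) (fun i => Real.exp (c₁ * r⁻¹) * u < Z i ω) bad
      fun i _ hi => by
        by_cases hb : bad i
        · exact Or.inr hb
        · refine Or.inl ?_
          nlinarith [(abs_le.1 (hWZ i hb)).2, exp_mul_add_le hc₁ hs hC₁]
    have hcard' := (Nat.cast_le (α := ℝ)).2 hcard
    push_cast at hcard'
    rw [← Nat.cast_lt (α := ℝ)]
    linarith [(abs_lt.1 h₁).2]
  have hlo : Real.exp (-C * r⁻¹) * u ≤ orderStat n k W ω := by
    refine le_orderStat hk hW ?_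
    have hcard := card_filter_le_add (Finset.Icc 1 n)
      (fun i => Real.exp (-c₂ * r⁻¹) * u < Z i ω) (fun i => Real.exp (-C * r⁻¹) * u < W i ω) bad
      fun i _ hi => by
        by_cases hb : bad i
        · exact Or.inr hb
        · refine Or.inl ?_
          nlinarith [(abs_le.1 (hWZ i hb)).1, exp_neg_mul_add_le hs hC₂ hhalf]
    have hcard' := (Nat.cast_le (α := ℝ)).2 hcard
    push_cast at hcard'
    rw [← Nat.cast_le (α := ℝ)]
    linarith [(abs_lt.1 h₂).1]
  have hpos : 0 < orderStat n k W ω := (by positivity : 0 < Real.exp (-C * r⁻¹) * u).trans_le hlo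
  have hup' := Real.log_le_log hpos hup
  have hlo' := Real.log_le_log (by positivity) hlo
  rw [Real.log_mul (Real.exp_pos _).ne' hu.ne', Real.log_exp] at hup' hlo'
  rw [abs_mul, abs_of_pos hr, mul_comm, ← le_div_iff₀ hr, div_eq_mul_inv, abs_le]
  constructor <;> linarith

lemma abs_Zhat_sub_le {Ω' : Type*} {p : ℕ} {φc : Fin p → ℝ} {X ξ : ℤ → Ω' → ℝ}
    (hmodel : ∀ (i : ℤ) ω, X i ω = ∑ j : Fin p, φc j * X (i - ((j : ℕ) + 1)) ω + ξ i ω)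
    (φh : Ω' → Fin p → ℝ) (i : ℕ) {ω : Ω'} {T : ℝ}
    (hT : ∀ j : Fin p, |X ((i : ℤ) - ((j : ℕ) + 1)) ω| ≤ T) :
    |Zhat p X φh i ω - abs (ξ i ω)| ≤ p * (‖(fun j => φh ω j - φc j : Fin p → ℝ)‖ * T) := by
  refine (abs_abs_sub_abs_le_abs_sub _ _).trans ?_
  have hdiff : residual p X φh i ω - ξ i ω =
      -∑ j : Fin p, (φh ω j - φc j) * X ((i : ℤ) - ((j : ℕ) + 1)) ω := by
    rw [residual, hmodel i ω]
    simp only [sub_mul, Finset.sum_sub_distrib]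
    ring
  rw [hdiff, abs_neg]
  refine (Finset.abs_sum_le_sum_abs _ _).trans ?_
  refine (Finset.sum_le_card_nsmul _ _ (‖(fun j => φh ω j - φc j : Fin p → ℝ)‖ * T)
    fun j _ => ?_).trans (le_of_eq (by simp))
  rw [abs_mul]
  gcongr
  · exact norm_le_pi_norm (fun j => φh ω j - φc j : Fin p → ℝ) j
  · exact hT j

variable [IsProbabilityMeasure (ℙ : Measure Ω)]

/-- The tail bound for the autoregression, including the degenerate order `p = 0`. -/
lemma exists_tail_bound_of_order_nonneg {p : ℕ} {φ : Fin p → ℝ} {X ξ : ℤ → Ω → ℝ}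
    (hX : ∀ i, Measurable (X i)) (hξ : ∀ i, Measurable (ξ i))
    (hmodel : ∀ (i : ℤ) ω, X i ω = ∑ j : Fin p, φ j * X (i - ((j : ℕ) + 1)) ω + ξ i ω)
    (hchar : ∀ z : ℂ, ‖z‖ < 1 → (1 : ℂ) - ∑ j : Fin p, (φ j : ℂ) * z ^ ((j : ℕ) + 1) ≠ 0)
    (hXid : ∀ i, Measure.map (X i) ℙ = Measure.map (X 1) (ℙ : Measure Ω))
    (hindep : iIndepFun ξ (ℙ : Measure Ω))
    (hξid : ∀ i, Measure.map (ξ i) ℙ = Measure.map (ξ 1) (ℙ : Measure Ω))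
    {α : ℝ} (hα : 0 < α) {l : ℝ → ℝ}
    (htail : ParetoTail (Measure.map (fun ω => |ξ 1 ω|) (ℙ : Measure Ω)) α l) :
    ∃ M B x₀ : ℝ, 0 < M ∧ 0 < B ∧ ∀ x, x₀ ≤ x → (ℙ : Measure Ω).real {ω | M * x < |X 1 ω|} ≤
      B * tailDF (Measure.map (fun ω => |ξ 1 ω|) (ℙ : Measure Ω)) x := by
  rcases Nat.eq_zero_or_pos p with rfl | hp
  · refine ⟨1, 1, 0, one_pos, one_pos, fun x _ => ?_⟩
    have hX1 : X 1 = ξ 1 := funext fun ω => by simpa using hmodel 1 ω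
    rw [hX1, tailDF_map_abs (hξ 1), one_mul, one_mul]
  · exact exists_tail_bound hX hξ hmodel hchar hXid hindep hξid hα hp htail

end Residuals

/-- Lemma 8 of Kim–Lee (2009): under (B1)–(B4),
`√k (log Ẑ_(k) - log b*(n/k)) = O_P(1)`. -/
theorem residual_order_stat_log_spacing_tight
    {Ω : Type*} [MeasureSpace Ω] [IsProbabilityMeasure (ℙ : Measure Ω)]
    (p : ℕ) (φc : Fin p → ℝ) (X ξ : ℤ → Ω → ℝ)
    (hXmeas : ∀ i, Measurable (X i)) (hξmeas : ∀ i, Measurable (ξ i))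
    (hmodel : ∀ (i : ℤ) ω, X i ω = ∑ j : Fin p, φc j * X (i - ((j : ℕ) + 1)) ω + ξ i ω)
    (hchar : ∀ z : ℂ, ‖z‖ < 1 →
      (1 : ℂ) - ∑ j : Fin p, (φc j : ℂ) * z ^ ((j : ℕ) + 1) ≠ 0)
    (hstat : IsStationaryZ X)
    (hindep : iIndepFun (m := fun _ : ℤ => Real.measurableSpace) ξ (ℙ : Measure Ω))
    (hident : ∀ i : ℤ, Measure.map (ξ i) (ℙ : Measure Ω) = Measure.map (ξ 1) (ℙ : Measure Ω))
    (α : ℝ) (hα : 0 < α) (lstar : ℝ → ℝ)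
    (hB1 : ParetoTail (Measure.map (fun ω => |ξ 1 ω|) (ℙ : Measure Ω)) α lstar)
    (g : ℝ → ℝ) (Kκ γ : ℝ) (hB2 : SecondOrderRV lstar g Kκ γ)
    (k : ℕ → ℕ) (hk : TailFraction k)
    (hB3 : Tendsto (fun n : ℕ => Real.sqrt (k n) * g ((quantileB (Measure.map (fun ω => |ξ 1 ω|) (ℙ : Measure Ω))) ((n : ℝ) / k n)))
      atTop (nhds 0))
    (φhat : ℕ → Ω → Fin p → ℝ) (hφhat : ∀ n, Measurable (φhat n))
    (d : ℕ → ℝ) (hd : Tendsto d atTop atTop)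
    (hdb : Tendsto (fun n : ℕ =>
        (Real.sqrt (k n) * (quantileB (Measure.map (fun ω => |ξ 1 ω|) (ℙ : Measure Ω))) ((n : ℝ) / Real.sqrt (k n)) / (quantileB (Measure.map (fun ω => |ξ 1 ω|) (ℙ : Measure Ω))) ((n : ℝ) / k n)) / d n)
      atTop (nhds 0))
    (hB4 : BddInProb (fun n ω => d n * ‖(fun j => φhat n ω j - φc j : Fin p → ℝ)‖)) :
    BddInProb (fun n ω => Real.sqrt (k n) *
      (Real.log (orderStat n (k n) (Zhat p X (φhat n)) ω)
        - Real.log ((quantileB (Measure.map (fun ω => |ξ 1 ω|) (ℙ : Measure Ω))) ((n : ℝ) / k n)))) := by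
  intro ε hε
  set μ := Measure.map (fun ω => |ξ 1 ω|) (ℙ : Measure Ω) with hμdef
  have : IsProbabilityMeasure μ := Measure.isProbabilityMeasure_map (hξmeas 1).abs.aemeasurable
  have hμ0 : μ (Iio 0) = 0 := by
    rw [hμdef, Measure.map_apply (hξmeas 1).abs measurableSet_Iio]
    convert measure_empty (μ := (ℙ : Measure Ω))
    ext ω
    simp
  have hXid := hstat.map_eq hXmeas
  obtain ⟨M, B, x₀, hM, hB, htail⟩ := exists_tail_bound_of_order_nonneg hXmeas hξmeas hmodel
    hchar hXid hindep hident hα hB1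
  obtain ⟨K', hK'⟩ := hB4 (ε / 4) (by positivity)
  set L := Real.sqrt (16 / ε)
  have hL : 0 < L := Real.sqrt_pos.2 (by positivity)
  have hL2 : L ^ 2 = 16 / ε := Real.sq_sqrt (by positivity)
  set K := (4 * (p * B) + 1) / ε
  have hK : 0 < K := by positivity
  obtain ⟨c₁, hc₁, hup⟩ := hB1.exists_upper_perturbation hα hB2 hk hB3 (add_pos hK hL)
  obtain ⟨c₂, hc₂, hlow⟩ := hB1.exists_lower_perturbation hα hμ0 hB2 hk hB3 (add_pos hK hL)
  have hhalf := (hk.tendsto_inv_sqrt.const_mul (-(max c₁ c₂ + 2))).rexp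
  rw [mul_zero, Real.exp_zero] at hhalf
  have hpert := hdb.const_mul (p * M * K')
  rw [mul_zero] at hpert
  have hq' := (tendsto_quantileB hB1.pos).comp hk.tendsto_div_sqrt
  refine ⟨max c₁ c₂ + 2, ?_⟩
  filter_upwards [hK', hup, hlow, hhalf.eventually_const_le (u := 1 / 2) (by norm_num),
    hpert.eventually_le_const one_pos, hq'.eventually_ge_atTop x₀, hq'.eventually_gt_atTop 0,
    ((tendsto_quantileB hB1.pos).comp hk.tendsto_div).eventually_gt_atTop 0,
    hk.tendsto_div_sqrt.eventually_gt_atTop 1, hd.eventually_gt_atTop 0, hk.eventually_pos,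
    hk.eventually_lt] with n hK'n hupn hlown hhalfn hpertn hx₀n hbn hun hnr hdn hkn hknn
  simp only [Function.comp_apply] at hx₀n hbn hun
  have hk0 : (0 : ℝ) < k n := by exact_mod_cast hkn
  have hn0 : (0 : ℝ) < n := by exact_mod_cast hkn.trans hknn
  set r := Real.sqrt (k n) with hrdef
  have hr : 0 < r := Real.sqrt_pos.2 hk0
  have hkr : r ^ 2 = k n := Real.sq_sqrt hk0.le
  set u := quantileB μ ((n : ℝ) / k n)
  set b := quantileB μ ((n : ℝ) / r)
  classical
  set S : ℕ → Set Ω := fun i => {ω | ∃ j : Fin p, M * b < |X ((i : ℤ) - ((j : ℕ) + 1)) ω|}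
  have hS : ∀ i, MeasurableSet (S i) := fun i =>
    measurableSet_setOfPred.2 (Measurable.exists fun j =>
      measurableSet_setOfPred.1 (measurableSet_lt measurable_const (hXmeas _).abs))
  have hSb : ∀ i, (ℙ : Measure Ω).real (S i) ≤ p * (B * (r / n)) := by
    intro i
    have h1 := measureReal_exists_lt_abs_le hXmeas hXid (Finset.univ : Finset (Fin p))
      (fun j => (i : ℤ) - ((j : ℕ) + 1)) (M * b)
    have h2 := tailDF_quantileB_le (μ := μ) hnr
    rw [inv_div] at h2
    simp only [Finset.mem_univ, true_and, Finset.card_univ, Fintype.card_fin] at h1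
    refine h1.trans ?_
    gcongr
    exact (htail _ hx₀n).trans (by gcongr)
  set E₀ : Set Ω := {ω | K' < |d n * ‖(fun j => φhat n ω j - φc j : Fin p → ℝ)‖|}
  set E₁ : Set Ω := {ω | K * r ≤ (((Finset.Icc 1 n).filter fun i => ω ∈ S i).card : ℝ)}
  set D : ℝ → Set Ω := fun v => {ω | L * r ≤ |(((Finset.Icc 1 n).filter fun i : ℕ =>
    v < |ξ i ω|).card : ℝ) - n * tailDF μ v|}
  have hE₁ : (ℙ : Measure Ω).real E₁ < ε / 4 := by
    refine (measureReal_card_filter_le _ hS (by positivity) fun i _ => hSb i).trans_lt ?_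
    rw [Nat.card_Icc, Nat.add_sub_cancel]
    have h1 : (n : ℝ) * (p * (B * (r / n))) / (K * r) = p * B / K := by field_simp
    rw [h1, div_lt_iff₀ hK]
    have h2 : ε / 4 * K = p * B + 1 / 4 := by simp only [K]; field_simp
    linarith
  have hD : ∀ v, n * tailDF μ v ≤ 2 * k n → (ℙ : Measure Ω).real (D v) < ε / 4 := by
    intro v hv
    refine (measureReal_exceedance_deviation_le hξmeas hindep hident n v
      (by positivity : 0 < L * r)).trans_lt ?_
    rw [div_lt_iff₀ (by positivity), mul_pow, hL2, hkr]
    refine hv.trans_lt ?_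
    have h1 : ε / 4 * (16 / ε * k n) = 4 * k n := by field_simp; norm_num
    linarith
  have hsub : {ω | max c₁ c₂ + 2 < |r * (Real.log (orderStat n (k n) (Zhat p X (φhat n)) ω) -
      Real.log u)|} ⊆ ((E₀ ∪ E₁) ∪ D (Real.exp (c₁ * r⁻¹) * u)) ∪ D (Real.exp (-c₂ * r⁻¹) * u) := by
    intro ω hω
    by_contra hcon
    simp only [mem_union, not_or] at hcon
    obtain ⟨⟨⟨h0, h1⟩, h2⟩, h3⟩ := hcon
    refine absurd (mem_ofPred_eq ▸ hω) (not_lt.2 ?_)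
    refine abs_sqrt_mul_log_orderStat_le (Z := fun i ω => |ξ i ω|) (bad := fun i => ω ∈ S i)
      hkn hknn.le hun hc₁.le (by linarith [le_max_left c₁ c₂]) (by linarith [le_max_right c₁ c₂])
      hhalfn (fun i => abs_nonneg _) (fun i hi => ?_) (not_le.1 h1) (not_le.1 h2) hupn
      (not_le.1 h3) hlown.1
    have hT : ∀ j : Fin p, |X ((i : ℤ) - ((j : ℕ) + 1)) ω| ≤ M * b := fun j =>
      not_lt.1 fun hj => hi ⟨j, hj⟩
    refine (abs_Zhat_sub_le hmodel (φhat n) i hT).trans ?_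
    have hnorm : ‖(fun j => φhat n ω j - φc j : Fin p → ℝ)‖ ≤ K' / d n := by
      rw [le_div_iff₀ hdn, mul_comm]
      exact (le_abs_self _).trans (not_lt.1 h0)
    calc p * (‖(fun j => φhat n ω j - φc j : Fin p → ℝ)‖ * (M * b))
        ≤ p * (K' / d n * (M * b)) := by gcongr
      _ = p * M * K' * (r * b / u / d n) * (u * r⁻¹) := by field_simp
      _ ≤ 1 * (u * r⁻¹) := by gcongr
      _ = u * r⁻¹ := one_mul _
  change (ℙ : Measure Ω).real _ < ε
  refine (measureReal_mono hsub).trans_lt ?_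
  have h1 := measureReal_union_le (μ := (ℙ : Measure Ω))
    ((E₀ ∪ E₁) ∪ D (Real.exp (c₁ * r⁻¹) * u)) (D (Real.exp (-c₂ * r⁻¹) * u))
  have h2 := measureReal_union_le (μ := (ℙ : Measure Ω)) (E₀ ∪ E₁) (D (Real.exp (c₁ * r⁻¹) * u))
  have h3 := measureReal_union_le (μ := (ℙ : Measure Ω)) E₀ E₁
  have h4 := hD (Real.exp (c₁ * r⁻¹) * u) (hupn.trans (by nlinarith [mul_pos (add_pos hK hL) hr]))
  have h5 := hD (Real.exp (-c₂ * r⁻¹) * u) hlown.2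
  have h6 : (ℙ : Measure Ω).real E₀ < ε / 4 := hK'n
  linarith

end TailCusum
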